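/- arXiv:2507.09387 — 3 statements merged into one kernel-verified Lean document; each statement's English description precedes it below -/
import Mathlib

section
/- Let w : ℕ → Σ₃ be an infinite word whose factor complexity equals 2n+1 for every n ≥ 0. Then the critical exponent of w is at least μ = 2 + 1/(λ² − 1), where λ is the unique real zero of x³ − 2x² + x − 1. -/
/-! Common definitions: the alphabet Σ₃, finite and infinite words, factors,
factor complexity, periods and exponents, morphisms, the morphism γ and its
fixed point G = γ^ω(0). -/

abbrev Sigma3 := Fin 3
abbrev Word := List Sigma3
abbrev InfWord := ℕ → Sigma3

/-- `u` is a factor of the infinite word `w`. -/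
def IsFactor (u : Word) (w : InfWord) : Prop :=
  ∃ i : ℕ, u = (List.range u.length).map (fun j => w (i + j))

/-- The set of finite factors of `w`. -/
def Lang (w : InfWord) : Set Word := {u | IsFactor u w}

/-- Factor complexity: the number of distinct length-`n` factors of `w`. -/
noncomputable def complexity (w : InfWord) (n : ℕ) : ℕ :=
  Set.ncard {u : Word | IsFactor u w ∧ u.length = n}

/-- `v` has period `p` (with `p ≥ 1`). -/
def HasPeriod (v : Word) (p : ℕ) : Prop :=
  1 ≤ p ∧ ∀ i, i + p < v.length → v.getD i 0 = v.getD (i + p) 0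

/-- The least period of `v`. -/
noncomputable def minPeriod (v : Word) : ℕ := sInf {p | HasPeriod v p}

/-- The exponent `|v| / p` of a nonempty finite word `v`, where `p` is its least period. -/
noncomputable def expo (v : Word) : ℝ := (v.length : ℝ) / (minPeriod v : ℝ)

/-- `w` contains no factor of exponent `5/2` or greater. -/
def NoFiveHalves (w : InfWord) : Prop :=
  ∀ u : Word, u ≠ [] → IsFactor u w → expo u < 5 / 2

/-- Apply a morphism (given by the images of the three letters) to a finite word. -/
def applyM (f : Sigma3 → Word) (u : Word) : Word := (u.map f).flatten

/-- The image under `f` of the length-`k` prefix of the infinite word `u`. -/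
def imPrefix (f : Sigma3 → Word) (u : InfWord) (k : ℕ) : Word :=
  applyM f ((List.range k).map u)

/-- The image of an infinite word under a (non-erasing) morphism. -/
def applyMInf (f : Sigma3 → Word) (u : InfWord) : InfWord :=
  fun n => (imPrefix f u (n + 1)).getD n 0

/-- The morphism `γ = [01, 2, 02]`. -/
def gam : Sigma3 → Word := ![[0, 1], [2], [0, 2]]

/-- The fixed point `G = γ^ω(0)` of `γ`, the unique infinite fixed point beginning with 0. -/
def G : InfWord := fun n => ((applyM gam)^[n + 1] [0]).getD n 0

/-- The final segment of `w` starting at position `k`. -/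
def shift (w : InfWord) (k : ℕ) : InfWord := fun i => w (i + k)

/-- The reverse `h^R` of a morphism `h`. -/
def mR (f : Sigma3 → Word) : Sigma3 → Word := fun x => (f x).reverse


/-! ### Factors, codes and occurrences -/

/-- The length-`n` factor of `w` starting at position `i`. -/
def fac (w : InfWord) (i n : ℕ) : Word := (List.range n).map fun j => w (i + j)

/-- `fac w i n` read as a number in base three. -/
def code (w : InfWord) (i : ℕ) : ℕ → ℕ
  | 0 => 0
  | n + 1 => 3 * code w i n + (w (i + n)).val

/-- A finite word read as a number in base three. -/
def enc (u : Word) : ℕ := u.foldl (fun a x => 3 * a + x.val) 0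

@[simp] theorem length_fac (w : InfWord) (i n : ℕ) : (fac w i n).length = n := by
  simp [fac]

theorem isFactor_iff {u : Word} {w : InfWord} : IsFactor u w ↔ ∃ i, fac w i u.length = u :=
  exists_congr fun _ => eq_comm

theorem isFactor_fac (w : InfWord) (i n : ℕ) : IsFactor (fac w i n) w :=
  ⟨i, by simp [fac]⟩

theorem fac_succ (w : InfWord) (i n : ℕ) : fac w i (n + 1) = w i :: fac w (i + 1) n := by
  simp [fac, List.range_succ_eq_map, Function.comp_def, Nat.add_assoc, Nat.add_comm 1]

theorem fac_succ' (w : InfWord) (i n : ℕ) : fac w i (n + 1) = fac w i n ++ [w (i + n)] := by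
  simp [fac, List.range_succ]

theorem fac_add (w : InfWord) (i a b : ℕ) :
    fac w i (a + b) = fac w i a ++ fac w (i + a) b := by
  induction b with
  | zero => simp [fac]
  | succ b ih => rw [← Nat.add_assoc, fac_succ', ih, fac_succ', List.append_assoc, Nat.add_assoc]

theorem fac_eq_fac_iff {w w' : InfWord} {i j n : ℕ} :
    fac w i n = fac w' j n ↔ ∀ t < n, w (i + t) = w' (j + t) := by
  simp [fac]

theorem code_eq_enc (w : InfWord) (i n : ℕ) : code w i n = enc (fac w i n) := by
  induction n with
  | zero => rfl
  | succ n ih => simp [code, ih, fac_succ', enc]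

theorem code_lt (w : InfWord) (i n : ℕ) : code w i n < 3 ^ n := by
  induction n with
  | zero => simp [code]
  | succ n ih =>
    have := (w (i + n)).isLt
    rw [code, pow_succ]
    omega

theorem code_add (w : InfWord) (i a b : ℕ) :
    code w i (a + b) = code w i a * 3 ^ b + code w (i + a) b := by
  induction b with
  | zero => simp [code]
  | succ b ih =>
    rw [← Nat.add_assoc, code, ih, code, pow_succ, Nat.add_assoc i a b]
    ring

theorem code_mod {w : InfWord} {i k n : ℕ} (h : k ≤ n) :
    code w i n % 3 ^ k = code w (i + (n - k)) k := by
  obtain ⟨a, rfl⟩ := Nat.exists_eq_add_of_le' h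
  rw [code_add, Nat.add_sub_cancel, Nat.mul_add_mod_self_right, Nat.mod_eq_of_lt (code_lt _ _ _)]

theorem code_div {w : InfWord} {i p n : ℕ} (h : p ≤ n) :
    code w i n / 3 ^ p = code w i (n - p) := by
  obtain ⟨a, rfl⟩ := Nat.exists_eq_add_of_le' h
  rw [code_add, Nat.add_sub_cancel, Nat.add_comm, Nat.add_mul_div_right _ _ (by positivity),
    Nat.div_eq_of_lt (code_lt _ _ _), Nat.zero_add]

theorem code_eq_code_iff {w w' : InfWord} {i j n : ℕ} :
    code w i n = code w' j n ↔ ∀ t < n, w (i + t) = w' (j + t) := by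
  induction n with
  | zero => simp [code]
  | succ n ih =>
    have h₁ := (w (i + n)).isLt
    have h₂ := (w' (j + n)).isLt
    rw [code, code, Nat.forall_lt_succ_right, ← ih, Fin.ext_iff]
    omega

theorem exists_fac_eq (u : Word) : ∃ w : InfWord, fac w 0 u.length = u :=
  ⟨fun n => u.getD n 0, List.ext_getElem (by simp) fun n h₁ h₂ => by simp [fac, h₂]⟩

theorem fac_eq_iff_code {w : InfWord} {i : ℕ} {u : Word} :
    fac w i u.length = u ↔ code w i u.length = enc u := by
  obtain ⟨v, hv⟩ := exists_fac_eq u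
  generalize u.length = n at hv ⊢
  subst hv
  rw [← code_eq_enc, fac_eq_fac_iff, code_eq_code_iff]

theorem fac_append_iff {w : InfWord} {i : ℕ} {u v : Word} :
    fac w i (u ++ v).length = u ++ v ↔
      fac w i u.length = u ∧ fac w (i + u.length) v.length = v := by
  rw [List.length_append, fac_add]
  constructor
  · intro h
    exact List.append_inj h (by simp)
  · rintro ⟨h₁, h₂⟩
    rw [h₁, h₂]

theorem IsFactor.of_append {w : InfWord} {a u b : Word} (h : IsFactor (a ++ u ++ b) w) :
    IsFactor u w := by
  rw [isFactor_iff] at h ⊢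
  obtain ⟨i, hi⟩ := h
  rw [fac_append_iff, fac_append_iff] at hi
  exact ⟨_, hi.1.2⟩

/-- The set of codes of the length-`n` factors of `w`. -/
def codeSet (w : InfWord) (n : ℕ) : Set ℕ := Set.range fun i => code w i n

theorem finite_codeSet (w : InfWord) (n : ℕ) : (codeSet w n).Finite :=
  (Set.finite_Iio (3 ^ n)).subset <| by
    rintro _ ⟨i, rfl⟩
    exact code_lt w i n

theorem ncard_codeSet (w : InfWord) (n : ℕ) : (codeSet w n).ncard = complexity w n := by
  have h : codeSet w n = enc '' {u : Word | IsFactor u w ∧ u.length = n} := by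
    ext x
    constructor
    · rintro ⟨i, rfl⟩
      exact ⟨fac w i n, ⟨isFactor_fac w i n, length_fac w i n⟩, (code_eq_enc w i n).symm⟩
    · rintro ⟨u, ⟨hu, rfl⟩, rfl⟩
      obtain ⟨i, hi⟩ := isFactor_iff.1 hu
      exact ⟨i, fac_eq_iff_code.1 hi⟩
  rw [h, complexity, Set.InjOn.ncard_image]
  rintro u ⟨hu, hl⟩ v ⟨-, hl'⟩ huv
  obtain ⟨i, hi⟩ := isFactor_iff.1 hu
  have h₁ := fac_eq_iff_code.1 hi
  rw [huv, hl, ← hl'] at h₁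
  rw [← hi, hl, ← hl', fac_eq_iff_code.2 h₁]

/-- Words of complexity `2n+1` without repetitions of exponent at least `2.481`. -/
structure Adm (w : InfWord) : Prop where
  card : ∀ n, (codeSet w n).ncard = 2 * n + 1
  nopow : ∀ i p k, 1 ≤ p → 2481 * p ≤ 1000 * k → ¬ ∀ t, t + p < k → w (i + t) = w (i + t + p)

/-! ### Exhaustive search for continuations -/

/-- Apply `f` to the evaluated form of `n`. -/
def force {α : Type} (n : ℕ) (f : ℕ → α) : α := Nat.rec (f 0) (fun k _ => f (Nat.succ k)) n

theorem force_eq {α : Type} (n : ℕ) (f : ℕ → α) : force n f = f n := by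
  cases n <;> rfl

/-- Membership of `x` in the finite set with bit mask `B`. -/
def tb (B x : ℕ) : Bool := Nat.beq (Nat.mod (Nat.shiftRight B x) 2) 1

theorem tb_eq_testBit (B x : ℕ) : tb B x = B.testBit x := by
  rw [Nat.testBit_eq_decide_div_mod_eq, ← Nat.shiftRight_eq_div_pow, Bool.eq_iff_iff]
  simp only [tb, Nat.beq_eq, decide_eq_true_eq]
  rfl

/-- The least length of a word of period `p` and exponent at least `2.481`. -/
def powLen (p : ℕ) : ℕ := Nat.div (Nat.add (Nat.mul 2481 p) 999) 1000

/-- The length-`n` word with code `W` has a suffix of exponent at least `2.481` with one of the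
listed periods. -/
def hasPow (n W : ℕ) : List ℕ → Bool
  | [] => false
  | p :: l => (Nat.ble (powLen p) n &&
      Nat.beq (Nat.div (Nat.mod W (Nat.pow 3 (powLen p))) (Nat.pow 3 p))
        (Nat.mod W (Nat.pow 3 (Nat.sub (powLen p) p)))) || hasPow n W l

/-- Record the suffixes of the length-`n` word with code `W` in a list of triples `(k, B, c)`, where
`B` is the set of length-`k` factors seen so far and `c` its size; `none` if there are too many. -/
def upd (n W : ℕ) : List (ℕ × ℕ × ℕ) → Option (List (ℕ × ℕ × ℕ))
  | [] => some []
  | (k, B, c) :: l =>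
    match upd n W l with
    | none => none
    | some ls =>
      bif !Nat.ble k n || tb B (Nat.mod W (Nat.pow 3 k)) then some ((k, B, c) :: ls)
      else bif Nat.ble (Nat.succ (Nat.mul 2 k)) c then none
      else force (Nat.lor B (Nat.pow 2 (Nat.mod W (Nat.pow 3 k)))) fun B' =>
        force (Nat.succ c) fun c' => some ((k, B', c') :: ls)

/-- All length-`M` factors have been seen. -/
def sat (M : ℕ) : List (ℕ × ℕ × ℕ) → Bool
  | [] => false
  | (k, _, c) :: _ => Nat.beq k M && Nat.beq c (Nat.succ (Nat.mul 2 k))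

/-- The mask of the first entry. -/
def headMask : List (ℕ × ℕ × ℕ) → ℕ
  | [] => 0
  | (_, B, _) :: _ => B

/-- The data of a search: only words all of whose length-`m` factors lie in `S` and without
repetitions with periods in `ps` are considered; the search is left when `halt` holds or when the
set of length-`M` factors is complete and is one of `leaves`. -/
structure Params where
  m : ℕ
  S : ℕ
  ps : List ℕ
  M : ℕ
  leaves : List ℕ
  halt : ℕ → ℕ → Bool

/-- Treat the length-`n` word with code `V`, continuing with `ih` if it is not excluded. -/
def visit (P : Params) (ih : ℕ → ℕ → List (ℕ × ℕ × ℕ) → Bool) (n V : ℕ)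
    (A : List (ℕ × ℕ × ℕ)) : Bool :=
  !tb P.S (Nat.mod V (Nat.pow 3 P.m)) || (hasPow n V P.ps ||
    match upd n V A with
    | none => true
    | some As => bif sat P.M As then P.leaves.any (Nat.beq (headMask As)) else ih n V As)

/-- Every infinite continuation of the length-`n` word with code `W` leaves the search. -/
def search (P : Params) : ℕ → ℕ → ℕ → List (ℕ × ℕ × ℕ) → Bool
  | 0, _, _, _ => false
  | f + 1, n, W, A => P.halt n W || force (Nat.succ n) fun n' => force (Nat.mul 3 W) fun V =>
      visit P (search P f) n' V A && (visit P (search P f) n' (Nat.succ V) A &&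
        visit P (search P f) n' (Nat.succ (Nat.succ V)) A)

/-- `B` is the mask of the set of length-`k` factors of `w`. -/
def Full (w : InfWord) (k B : ℕ) : Prop := ∀ x, x ∈ codeSet w k ↔ tb B x = true

/-- A correct record of length-`k` factors. -/
def Valid (w : InfWord) (a : ℕ × ℕ × ℕ) : Prop :=
  {x | tb a.2.1 x = true} ⊆ codeSet w a.1 ∧ {x | tb a.2.1 x = true}.ncard = a.2.2

theorem valid_empty (w : InfWord) (k : ℕ) : Valid w (k, 0, 0) := by
  simp [Valid, tb_eq_testBit]

theorem Valid.le {w : InfWord} (hw : Adm w) {a : ℕ × ℕ × ℕ} (h : Valid w a) :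
    a.2.2 ≤ 2 * a.1 + 1 := by
  rw [← h.2, ← hw.card]
  exact Set.ncard_le_ncard h.1 (finite_codeSet _ _)

theorem Valid.full {w : InfWord} (hw : Adm w) {k B c : ℕ} (h : Valid w (k, B, c))
    (hc : c = 2 * k + 1) : Full w k B := by
  have := Set.eq_of_subset_of_ncard_le h.1 (by rw [h.2, hw.card]; exact hc.ge) (finite_codeSet _ _)
  intro x
  exact (Set.ext_iff.1 this x).symm

theorem Valid.add_code {w : InfWord} {k B c x : ℕ} (h : Valid w (k, B, c)) (hx : x ∈ codeSet w k)
    (hB : tb B x = false) : Valid w (k, B ||| 2 ^ x, c + 1) := by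
  have key : {y | tb (B ||| 2 ^ x) y = true} = insert x {y | tb B y = true} := by
    ext y
    simp only [Set.mem_ofPred_eq, Set.mem_insert_iff, tb_eq_testBit, Nat.testBit_or,
      Nat.testBit_two_pow, Bool.or_eq_true, decide_eq_true_eq]
    rw [or_comm, eq_comm]
  refine ⟨?_, ?_⟩
  · dsimp only
    rw [key]
    exact Set.insert_subset hx h.1
  · dsimp only
    rw [key, Set.ncard_insert_of_notMem (by simp [hB]) ((finite_codeSet w k).subset h.1), h.2]

theorem code_mod_mem {w : InfWord} {i k n : ℕ} (h : k ≤ n) :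
    code w i n % 3 ^ k ∈ codeSet w k :=
  ⟨i + (n - k), (code_mod h).symm⟩

theorem hasPow_eq_false {w : InfWord} (hw : Adm w) (i n : ℕ) {ps : List ℕ}
    (hps : ∀ p ∈ ps, 1 ≤ p) : hasPow n (code w i n) ps = false := by
  induction ps with
  | nil => rfl
  | cons p l ih =>
    rw [List.forall_mem_cons] at hps
    rw [hasPow, ih hps.2, Bool.or_false, Bool.eq_false_iff, Ne, Bool.and_eq_true, Nat.ble_eq,
      Nat.beq_eq]
    rintro ⟨hk, he⟩
    have hk' : 2481 * p ≤ 1000 * powLen p := by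
      change 2481 * p ≤ 1000 * ((2481 * p + 999) / 1000)
      omega
    have hpk : p ≤ powLen p := by omega
    change code w i n % 3 ^ powLen p / 3 ^ p = code w i n % 3 ^ (powLen p - p) at he
    rw [code_mod hk, code_div hpk, code_mod (by omega), code_eq_code_iff] at he
    refine hw.nopow (i + (n - powLen p)) p (powLen p) hps.1 hk' fun t ht => ?_
    rw [he t (by omega)]
    congr 1
    omega

theorem exists_upd_eq {w : InfWord} (hw : Adm w) (i n : ℕ) {A : List (ℕ × ℕ × ℕ)}
    (hA : ∀ a ∈ A, Valid w a) :
    ∃ A', upd n (code w i n) A = some A' ∧ ∀ a ∈ A', Valid w a := by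
  induction A with
  | nil => exact ⟨[], rfl, by simp⟩
  | cons a l ih =>
    obtain ⟨k, B, c⟩ := a
    rw [List.forall_mem_cons] at hA
    obtain ⟨l', hl, hv⟩ := ih hA.2
    rw [upd, hl]
    dsimp only
    by_cases h : (!Nat.ble k n || tb B (Nat.mod (code w i n) (Nat.pow 3 k))) = true
    · rw [h]
      exact ⟨_, rfl, List.forall_mem_cons.2 ⟨hA.1, hv⟩⟩
    · rw [Bool.not_eq_true] at h
      rw [h]
      simp only [Bool.or_eq_false_iff, Bool.not_eq_false', Nat.ble_eq] at h
      have hins := hA.1.add_code (code_mod_mem (w := w) (i := i) h.1) h.2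
      have hle := hins.le hw
      have hc : Nat.ble (Nat.succ (Nat.mul 2 k)) c = false := by
        rw [Bool.eq_false_iff, Ne, Nat.ble_eq]
        change ¬ 2 * k + 1 ≤ c
        dsimp only at hle
        omega
      rw [hc, force_eq, force_eq]
      exact ⟨_, rfl, List.forall_mem_cons.2 ⟨hins, hv⟩⟩

/-- The possible outcomes of a search at position `i` of `w`. -/
def Outcome (w : InfWord) (P : Params) (i : ℕ) : Prop :=
  (∃ n, P.halt n (code w i n) = true) ∨ ∃ B ∈ P.leaves, Full w P.M B

theorem outcome_of_visit {w : InfWord} (hw : Adm w) {P : Params} (hS : Full w P.m P.S)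
    (hps : ∀ p ∈ P.ps, 1 ≤ p) {i n : ℕ} {ih : ℕ → ℕ → List (ℕ × ℕ × ℕ) → Bool}
    (hih : ∀ A, (∀ a ∈ A, Valid w a) → ih n (code w i n) A = true → Outcome w P i)
    (hn : P.m ≤ n) {A : List (ℕ × ℕ × ℕ)} (hA : ∀ a ∈ A, Valid w a)
    (h : visit P ih n (code w i n) A = true) : Outcome w P i := by
  obtain ⟨A', hA', hv⟩ := exists_upd_eq hw i n hA
  have hwin : tb P.S (Nat.mod (code w i n) (Nat.pow 3 P.m)) = true :=
    (hS _).1 (code_mod_mem hn)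
  rw [visit, hwin, hasPow_eq_false hw i n hps, hA'] at h
  simp only [Bool.not_true, Bool.false_or] at h
  cases hs : sat P.M A' with
  | false =>
    rw [hs] at h
    exact hih A' hv h
  | true =>
    rw [hs, cond_true, List.any_eq_true] at h
    obtain ⟨B, hB, hBe⟩ := h
    cases A' with
    | nil => simp [sat] at hs
    | cons a l =>
      obtain ⟨k, B', c⟩ := a
      simp only [sat, Bool.and_eq_true, Nat.beq_eq] at hs
      rw [Nat.beq_eq] at hBe
      obtain rfl : B' = B := hBe
      obtain ⟨rfl, hc⟩ := hs
      exact Or.inr ⟨B', hB, (hv _ List.mem_cons_self).full hw hc⟩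

theorem outcome_of_search {w : InfWord} (hw : Adm w) {P : Params} (hS : Full w P.m P.S)
    (hps : ∀ p ∈ P.ps, 1 ≤ p) {i : ℕ} (f : ℕ) {n : ℕ} (hn : P.m ≤ n) {A : List (ℕ × ℕ × ℕ)}
    (hA : ∀ a ∈ A, Valid w a) (h : search P f n (code w i n) A = true) : Outcome w P i := by
  induction f generalizing n A with
  | zero => simp [search] at h
  | succ f ih =>
    rw [search, force_eq, force_eq, Bool.or_eq_true] at h
    rcases h with h | h
    · exact Or.inl ⟨n, h⟩
    rw [Bool.and_eq_true, Bool.and_eq_true] at h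
    have key : visit P (search P f) (n + 1) (code w i (n + 1)) A = true := by
      rw [code]
      generalize w (i + n) = a
      fin_cases a
      exacts [h.1, h.2.1, h.2.2]
    exact outcome_of_visit hw hS hps (fun A hA h => ih (hn.trans n.le_succ) hA h)
      (hn.trans n.le_succ) hA key

/-! ### Recognising images of a morphism -/

/-- The pairs of letters allowed in preimages. -/
def pairs : List (Fin 3 × Fin 3) := [(0, 1), (0, 2), (1, 0), (1, 2), (2, 0)]

/-- The third power of `gam`. -/
def gamCube : Fin 3 → Word := ![[0, 1, 2, 0, 2], [0, 1, 0, 2], [0, 1, 2, 0, 1, 0, 2]]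

/-- The morphism with the given images of letters. -/
def mor (d : Word × Word × Word) : Fin 3 → Word := ![d.1, d.2.1, d.2.2]

/-- The composition of `h` with the third power of `gam`. -/
def img (h : Fin 3 → Word) (x : Fin 3) : Word := applyM h (gamCube x)

/-- Length and code of a word. -/
def mark (u : Word) : ℕ × ℕ := force u.length fun l => force (enc u) fun c => (l, c)

/-- The marks of the images of the allowed pairs. -/
def pairMarks (h : Fin 3 → Word) : List (ℕ × ℕ) :=
  pairs.map fun x => mark (img h x.1 ++ img h x.2)

/-- The marks of the images of the allowed extensions of an allowed pair. -/
def tripleMarks (h : Fin 3 → Word) (x : Fin 3 × Fin 3) : List (ℕ × ℕ) :=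
  (pairs.filter fun y => y.1 == x.2).map fun y => mark (img h x.1 ++ img h x.2 ++ img h y.2)

/-- The length-`n` word with code `W` ends with a marked word. -/
def suffixHalt (L : List (ℕ × ℕ)) (n W : ℕ) : Bool :=
  L.any fun x => Nat.ble x.1 n && Nat.beq (Nat.mod W (Nat.pow 3 x.1)) x.2

/-- The length-`n` word with code `W` is a marked word. -/
def exactHalt (L : List (ℕ × ℕ)) (n W : ℕ) : Bool :=
  L.any fun x => Nat.beq n x.1 && Nat.beq W x.2

/-- The image of an allowed pair is always followed by the image of an allowed letter. -/
def decodeCheck (m S : ℕ) (ps : List ℕ) (h : Fin 3 → Word) : Bool :=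
  pairs.all fun x => force (img h x.1 ++ img h x.2).length fun l =>
    force (enc (img h x.1 ++ img h x.2)) fun c =>
      Nat.ble m l && search ⟨m, S, ps, 0, [], exactHalt (tripleMarks h x)⟩ 300 l c []

/-- Search data for words whose set of length-`m` factors has mask `S`: a factor `t` to start with,
the lengths `accs` for which factors are counted, periods, and morphisms with periods. -/
structure Node where
  S : ℕ
  t : ℕ
  accs : List ℕ
  ps : List ℕ
  decs : List ((Word × Word × Word) × List ℕ)

/-- Every word with the given factors of length `m` contains the image of an allowed pair, and this
image can only be continued by images of allowed pairs. -/
def Node.check (m : ℕ) (e : Node) : Bool :=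
  tb e.S e.t && (e.ps.all (Nat.ble 1) && (e.decs.all (fun d => d.2.all (Nat.ble 1) &&
    ([0, 1, 2].all fun x => !(mor d.1 x).isEmpty) && decodeCheck m e.S d.2 (mor d.1)) &&
    search ⟨m, e.S, e.ps, 0, [], suffixHalt (e.decs.flatMap fun d => pairMarks (mor d.1))⟩ 300 m e.t
      (e.accs.map fun k => (k, 0, 0))))

/-- A suitable image of a word with only allowed pairs has all its factors in `w`. -/
def Decoded (w : InfWord) : Prop :=
  ∃ h : Fin 3 → Word, (∀ x, h x ≠ []) ∧ ∃ y : InfWord, (∀ n, (y n, y (n + 1)) ∈ pairs) ∧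
    ∀ u, IsFactor u y → IsFactor (applyM (img h) u) w

theorem mark_eq (u : Word) : mark u = (u.length, enc u) := by
  rw [mark, force_eq, force_eq]

theorem applyM_cons (f : Fin 3 → Word) (a : Fin 3) (u : Word) :
    applyM f (a :: u) = f a ++ applyM f u := by
  simp [applyM]

@[simp] theorem applyM_nil (f : Fin 3 → Word) : applyM f [] = [] := rfl

theorem applyM_append (f : Fin 3 → Word) (u v : Word) :
    applyM f (u ++ v) = applyM f u ++ applyM f v := by
  simp [applyM]

theorem isFactor_applyM {w y : InfWord} {g : Fin 3 → Word} {pos : ℕ → ℕ}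
    (hpos : ∀ n, pos (n + 1) = pos n + (g (y n)).length)
    (hocc : ∀ n, fac w (pos n) (g (y n)).length = g (y n)) {u : Word} (hu : IsFactor u y) :
    IsFactor (applyM g u) w := by
  obtain ⟨i, hi⟩ := isFactor_iff.1 hu
  rw [← hi, isFactor_iff]
  refine ⟨pos i, ?_⟩
  generalize u.length = n
  clear hi hu
  induction n generalizing i with
  | zero => rfl
  | succ n ih => rw [fac_succ, applyM_cons, fac_append_iff, ← hpos]; exact ⟨hocc i, ih (i + 1)⟩

theorem exists_pair_of_decodeCheck {w : InfWord} (hw : Adm w) {m S : ℕ} (hS : Full w m S)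
    {ps : List ℕ} (hps : ∀ p ∈ ps, 1 ≤ p) {h : Fin 3 → Word} (hc : decodeCheck m S ps h = true)
    {x : Fin 3 × Fin 3} (hx : x ∈ pairs) {i : ℕ}
    (ho : fac w i (img h x.1 ++ img h x.2).length = img h x.1 ++ img h x.2) :
    ∃ y ∈ pairs, y.1 = x.2 ∧ fac w (i + (img h x.1).length) (img h y.1 ++ img h y.2).length =
      img h y.1 ++ img h y.2 := by
  rw [decodeCheck, List.all_eq_true] at hc
  have hx' := hc x hx
  rw [force_eq, force_eq, Bool.and_eq_true, Nat.ble_eq, ← fac_eq_iff_code.1 ho] at hx'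
  rcases outcome_of_search hw hS hps 300 hx'.1 (by simp) hx'.2 with ⟨n, hn⟩ | ⟨B, hB, -⟩
  · simp only [exactHalt, tripleMarks, List.any_eq_true, List.mem_map, List.mem_filter,
      Bool.and_eq_true, Nat.beq_eq, beq_iff_eq] at hn
    obtain ⟨_, ⟨y, ⟨hy, hyx⟩, rfl⟩, hl, hcode⟩ := hn
    refine ⟨y, hy, hyx, ?_⟩
    rw [mark_eq] at hl hcode
    dsimp only at hl hcode
    rw [hl, ← fac_eq_iff_code, List.append_assoc, fac_append_iff] at hcode
    rw [hyx]
    exact hcode.2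
  · simp at hB

theorem decoded_of_decodeCheck {w : InfWord} (hw : Adm w) {m S : ℕ} (hS : Full w m S)
    {ps : List ℕ} (hps : ∀ p ∈ ps, 1 ≤ p) {h : Fin 3 → Word} (hh : ∀ x, h x ≠ [])
    (hc : decodeCheck m S ps h = true) {x : Fin 3 × Fin 3} (hx : x ∈ pairs) {i : ℕ}
    (ho : fac w i (img h x.1 ++ img h x.2).length = img h x.1 ++ img h x.2) : Decoded w := by
  let Q : ℕ × (Fin 3 × Fin 3) → Prop := fun s => s.2 ∈ pairs ∧
    fac w s.1 (img h s.2.1 ++ img h s.2.2).length = img h s.2.1 ++ img h s.2.2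
  have step : ∀ s : Subtype Q, ∃ s' : Subtype Q,
      s'.1.2.1 = s.1.2.2 ∧ s'.1.1 = s.1.1 + (img h s.1.2.1).length := by
    rintro ⟨⟨i, x⟩, hx, ho⟩
    obtain ⟨y, hy, hyx, ho'⟩ := exists_pair_of_decodeCheck hw hS hps hc hx ho
    exact ⟨⟨(_, y), hy, ho'⟩, hyx, rfl⟩
  choose next hnext hpos using step
  let s : ℕ → Subtype Q := fun n => next^[n] ⟨(i, x), hx, ho⟩
  have hs : ∀ n, s (n + 1) = next (s n) := fun n => Function.iterate_succ_apply' _ _ _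
  refine ⟨h, hh, fun n => (s n).1.2.1, fun n => ?_, fun u hu => ?_⟩
  · dsimp only
    rw [hs, hnext]
    exact (s n).2.1
  · refine isFactor_applyM (pos := fun n => (s n).1.1) (fun n => ?_) (fun n => ?_) hu
    · rw [hs, hpos]
    · exact (fac_append_iff.1 (s n).2.2).1

theorem decoded_of_check {w : InfWord} (hw : Adm w) {m : ℕ} {e : Node} (hS : Full w m e.S)
    (hc : e.check m = true) : Decoded w := by
  rw [Node.check, Bool.and_eq_true, Bool.and_eq_true, Bool.and_eq_true] at hc
  obtain ⟨ht, hps, hdec, hsearch⟩ := hc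
  obtain ⟨i, hi⟩ := (hS e.t).2 ht
  dsimp only at hi
  have hps' : ∀ p ∈ e.ps, 1 ≤ p := by simpa [List.all_eq_true] using hps
  rw [← hi] at hsearch
  rcases outcome_of_search hw hS hps' 300 le_rfl
    (by simp only [List.mem_map]; rintro _ ⟨k, -, rfl⟩; exact valid_empty w k) hsearch with
    ⟨n, hn⟩ | ⟨B, hB, -⟩
  · simp only [suffixHalt, pairMarks, List.any_eq_true, List.mem_map, List.mem_flatMap,
      Bool.and_eq_true, Nat.beq_eq, Nat.ble_eq] at hn
    obtain ⟨_, ⟨d, hd, x, hx, rfl⟩, hl, hcode⟩ := hn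
    rw [List.all_eq_true] at hdec
    have hd' := hdec d hd
    rw [Bool.and_eq_true, Bool.and_eq_true] at hd'
    obtain ⟨⟨hdps, hne⟩, hdc⟩ := hd'
    rw [mark_eq] at hl hcode
    dsimp only at hl hcode
    change code w i n % 3 ^ _ = _ at hcode
    rw [code_mod hl, ← fac_eq_iff_code] at hcode
    refine decoded_of_decodeCheck hw hS (by simpa [List.all_eq_true] using hdps) (fun z => ?_)
      hdc hx hcode
    have := List.all_eq_true.1 hne z (by fin_cases z <;> simp)
    simpa using this
  · simp at hB

/-- Search data for words whose set of length-`m` factors has mask `S`, whose sets of longer factors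
are to be determined. -/
structure Branch where
  S : ℕ
  t : ℕ
  ps : List ℕ

/-- The set of length-`M` factors has one of the masks in `leaves`. -/
def Branch.check (m M : ℕ) (leaves : List ℕ) (e : Branch) : Bool :=
  tb e.S e.t && (e.ps.all (Nat.ble 1) &&
    search ⟨m, e.S, e.ps, M, leaves, fun _ _ => false⟩ 100 m e.t [(M, 0, 0), (M - 1, 0, 0)])

theorem full_of_check {w : InfWord} (hw : Adm w) {m M : ℕ} {leaves : List ℕ} {e : Branch}
    (hS : Full w m e.S) (hc : e.check m M leaves = true) : ∃ B ∈ leaves, Full w M B := by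
  rw [Branch.check, Bool.and_eq_true, Bool.and_eq_true] at hc
  obtain ⟨ht, hps, hsearch⟩ := hc
  obtain ⟨i, hi⟩ := (hS e.t).2 ht
  dsimp only at hi
  have hps' : ∀ p ∈ e.ps, 1 ≤ p := by simpa [List.all_eq_true] using hps
  rw [← hi] at hsearch
  rcases outcome_of_search hw hS hps' 100 le_rfl (by simp [valid_empty]) hsearch with
    ⟨n, hn⟩ | h
  · simp at hn
  · exact h

/-! ### Search data -/

/-- Search data for the occurring sets of factors of length 6. -/
def nodes6 : List Node :=
  [⟨160893695159311165194888299978470153529752389847108720532682737326698204337224496686630012164230397702308215088330835975946478466234616249014328052317945856, 29, [], [5, 7, 8],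
      [(([0], [0, 1], [0, 2, 0, 1]), [5, 7, 8, 12, 15])]⟩,
    ⟨1877093110191963593940363499748818457847111214882935072881298602123084000186638480769247613000545180553898013385637101924436733642172379128258854537616424960, 514, [], [4, 5, 8, 9, 12, 17, 21, 38], []⟩,
    ⟨1877093110191963593940363499748818457847111214882935072881298602123084000186638502480264344997331822473457702514619824412558858449778136526555856029381296128, 514, [], [4, 5, 7],
      [(([0, 1], [0], [0, 2]), [4, 5, 7, 9, 12])]⟩,
    ⟨1716356946955657430572969584524508132526559250934292174841609748195003199270616852558295001804863856502687959098677871582421288798622951856808228087807344640, 55, [], [5, 7, 8],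
      [(([0], [0, 2], [0, 1, 0, 2]), [5, 7, 8, 12, 15])]⟩,
    ⟨1716252198456204754033129162454209649353688318388818796768346282873261158965466389058807182850318805730710599118451725910785135563418465052079144589735231488, 299, [], [4, 5, 8, 9, 12, 17, 21, 38], []⟩,
    ⟨1716304572705931092303049373489358890940123784661555485804978015535150697106208863851685315171796020197225013305397766871921283039523199218476084237233553408, 299, [], [4, 5, 7],
      [(([0, 2], [0], [0, 1]), [4, 5, 7, 9, 12])]⟩,
    ⟨53631334013226885152729537905001410372390970052433512356668917130288604094893469346150781066680791462515229028414095927902483709603585318042261528520949760, 252, [], [3], []⟩,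
    ⟨53631743187052872170463289553713513822284997132689267739767602541709616111618012693464564143180118227348309846255371043537318259225401087617392700016295936, 100, [], [5, 7],
      [(([1, 0], [2, 0], [0]), [5, 7, 8, 12])]⟩,
    ⟨1716199926499934912517642389331238433629726358886146046577489221563208355840737837816896977115876143260921239727439402416932243167518984603847931226314768384, 100, [], [4, 5, 8, 9, 12, 17, 21, 38], []⟩,
    ⟨1769831055926248804161505051411883792277170315398451681242608795985240158956850888078024634206353371787179449350329721323271520807264906772339388255402196992, 99, [], [4, 5],
      [(([0], [2], [0, 1]), [4, 5, 7, 9])]⟩,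
    ⟨878694110316889867206108912321988780102245071470204171403055865921059442436008103928077561525147162017685767576952733293453546251078851898649707239036455747584, 409, [], [4, 5, 8, 9, 13],
      [(([0], [0, 1, 2], [0, 1, 1, 2]), [4, 5, 8, 9, 13, 17])]⟩,
    ⟨878694110316889867206108912321988780102245081320705720501675668990819467471911555198012379141508829004759118638383175471028052834023911678619108653779296190464, 410, [], [4, 5, 9, 13, 18], []⟩,
    ⟨878694110316889867206108912321988780102245081320705720501675668990819467471911555198012379141508829004759118638383176080814054356345638204986405206692303208448, 410, [], [4, 5, 8],
      [(([1, 2, 0], [0], [1]), [4, 5, 8, 9, 13])]⟩,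
    ⟨1823566626971645882081907821826293556510064684146038877443667821670957502359665697514512174392618646993975069244426492039258261243443413149054965524046282752, 173, [], [5, 7],
      [(([2, 0], [1, 0], [0]), [5, 7, 8, 12])]⟩,
    ⟨1823619001221372220351828032861442798096500150418775566480299554332847040500400761613679118477588752917448927405269923721375807723449622029967312340190756864, 504, [], [3], []⟩,
    ⟨1823566626971645882081907821826293556510064684146038877443667821671976020347832940557646397236823336074500803441259460164576332101945903913051334625489584128, 173, [], [4, 5, 8, 9, 12, 17, 21, 38], []⟩,
    ⟨1823566626971645882081907821826293556510064684146038877443667821672994538335996478253925025962774470883506259625041123650385102462399132034287392912746479616, 87, [], [4, 5],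
      [(([0], [1], [0, 2]), [4, 5, 7, 9])]⟩,
    ⟨28807108248784111855009943754764402521364445902114114722122063588554212645362513317350330485678963479201335624753970937901920807027430397618677885473915455928270848, 140, [], [3], []⟩,
    ⟨28821167354392059343706226687600921214673413705608808211600503449718624637802111716945077487823038138129929127599700690699180832858853817305206037083855659565318144, 140, [], [5, 7, 10, 12, 22], []⟩,
    ⟨28835226460000006832402509620437439907982381509103501701078943310883036630239720823594185343398491268065935347085028618893251467820515381084161550705745729700233216, 140, [], [3, 5, 10], []⟩,
    ⟨115186253104013482404972283102335254211662630573510914077656570582701494194255080427475911658873667936479817109103147756169248244234752036966624129650358292523778048, 140, [], [3], []⟩,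
    ⟨115214371315229377382364848968008291595572880932335442795306405203328087999997131645243709788971895788893037993890675989263793289936525069603946828415743024183640064, 140, [], [], []⟩,
    ⟨115214371315229377382364848968008291598280566180500301056613450305030318179132287933719766516593195725344416831434205437160578905027837020432107794882188566295740416, 138, [], [3, 5, 13], []⟩,
    ⟨143979301389089939254959729551525538105721006882478322268194361145715024531415457216096076175748647956795344816259736523162919722806895877369004935209869842684313600, 545, [], [5, 7, 10, 12],
      [(([0, 1, 2], [0, 2], [0, 1]), [5, 7, 10, 12, 17])]⟩,
    ⟨143993360494697886743656012484362056799029974685973015757672801006879436523855055615690823177892722615723938319105466275960179748638319297055533086819810046321360896, 545, [], [5, 7, 12, 17, 24], []⟩,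
    ⟨144007419600305834232352295417198575492338942489467709247151240868043848516293659368812750606752486510156238180270995116455845079034861788788274919435725183207342080, 543, [], [5, 7, 10, 12, 17],
      [(([2, 0], [2, 0, 1], [2, 0, 1, 0, 1]), [5, 7, 10, 12, 17, 22])]⟩,
    ⟨143993360494697886743656012484362056801653044770132722198314000949153472009894165397693091056014209035372780498731149696195575883094290670290534502929133124018241536, 289, [], [5, 7, 10, 12, 22], []⟩,
    ⟨144007419600305834232352295417198575494962012573627415687792440810317884002331774504342198911589662165308786718216477624389646518055952234069490016551023194153156608, 532, [], [3], []⟩]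

/-- Search data for some of the occurring sets of factors of length 4. -/
def branches4 : List Branch :=
  [⟨144115197471623752, 11, [3, 4, 5, 7, 8, 9, 12, 15]⟩,
    ⟨252201587723470920, 19, [3, 4, 5, 7, 8, 9, 12, 15]⟩,
    ⟨180143993953978888, 18, [3, 4, 5, 7, 8, 9, 12, 15]⟩,
    ⟨324369124333502512, 46, [4, 5, 8, 9, 13]⟩,
    ⟨216172791241378368, 9, [3, 4, 5, 7, 8, 9, 12, 15]⟩,
    ⟨1873708555514184704, 59, [3, 5, 7, 10, 12, 17]⟩]

/-- Search data for the other occurring sets of factors of length 4. -/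
def nodes4 : List Node :=
  [⟨36028935800100376, 10, [], [2], []⟩,
    ⟨144115326856992280, 10, [], [2], []⟩,
    ⟨288230514932848152, 10, [], [2], []⟩,
    ⟨36028868154365464, 10, [], [3, 4, 6, 7, 13], []⟩,
    ⟨144115259211257368, 10, [], [3, 4, 6, 7, 13], []⟩,
    ⟨288230447287113240, 10, [], [3, 4, 6, 7, 13], []⟩,
    ⟨36028937947583000, 4, [], [3, 6], []⟩,
    ⟨36029004519576088, 37, [], [3, 4, 6, 7, 13], []⟩,
    ⟨144115395576467992, 37, [], [3, 4, 6, 7, 13], []⟩,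
    ⟨288230583652323864, 37, [], [3, 4, 6, 7, 13], []⟩,
    ⟨36029005593317912, 3, [], [3, 4, 7, 10], []⟩,
    ⟨144115396650209816, 3, [], [3, 4, 7, 10], []⟩,
    ⟨288230584726065688, 3, [], [3, 4, 7, 10], []⟩,
    ⟨36029005593318424, 3, [], [3, 4, 6, 7, 13], []⟩,
    ⟨144115396650210328, 3, [], [3, 4, 6, 7, 13], []⟩,
    ⟨288230584726066200, 3, [], [3, 4, 6, 7, 13], []⟩,
    ⟨36063985954489896, 10, [], [3, 4, 6, 7, 9, 13],
      [(([0, 1], [0], [0, 1, 2, 0]), [3, 4, 6, 7, 9, 13, 16])]⟩,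
    ⟨144185561383470632, 10, [], [3, 5, 6, 8, 11],
      [(([0, 1], [0], [0, 1, 2]), [3, 5, 6, 8, 11, 14])]⟩,
    ⟨18447025550028506664, 10, [], [2], []⟩,
    ⟨9223653516394956328, 5, [], [3, 5, 7, 8, 12],
      [(([0], [0, 1], [0, 1, 2, 1]), [3, 5, 7, 8, 12, 15])]⟩,
    ⟨180249538479555112, 46, [], [3, 4, 6, 7],
      [(([0, 1], [2], [0]), [3, 4, 6, 7, 10])]⟩,
    ⟨612595102707122728, 46, [], [3, 4, 7, 10, 14, 17, 31], []⟩,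
    ⟨720681493764014632, 45, [], [], []⟩,
    ⟨18447025554323472936, 3, [], [3, 4, 7], []⟩,
    ⟨27670397586883281448, 3, [], [3, 5, 7, 8],
      [(([0, 1], [2, 1], [0]), [3, 5, 7, 8, 12])]⟩,
    ⟨27670397590104506920, 64, [5, 6, 7, 8, 9], [3, 4, 5, 8, 9, 12, 17, 21, 22, 38], []⟩,
    ⟨180249542506087464, 46, [], [4, 5],
      [(([1], [2, 0], [0]), [4, 5, 6, 9])]⟩,
    ⟨612595106733655080, 46, [], [3, 4, 6, 7, 9],
      [(([2], [0, 0, 1], [0, 1]), [3, 4, 6, 7, 9, 13])]⟩,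
    ⟨27670397590104507432, 3, [], [4, 5, 7, 9],
      [(([1, 0], [0], [1, 2]), [4, 5, 7, 9, 12])]⟩,
    ⟨36028806414469704, 11, [], [3, 5, 6, 8, 11],
      [(([0, 1], [0], [0, 2, 0]), [3, 5, 6, 8, 11, 14])]⟩,
    ⟨108086399915526728, 9, [5, 6, 7, 8, 9], [3, 5, 8, 11, 16, 21], []⟩,
    ⟨108086400183962184, 9, [], [3, 5, 6, 8],
      [(([0], [0, 1], [0, 2]), [3, 5, 6, 8, 11])]⟩,
    ⟨108086391862985288, 19, [], [], []⟩,
    ⟨180143985900913224, 18, [], [3, 5, 6, 8],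
      [(([0], [0, 2], [0, 1]), [3, 5, 6, 8, 11])]⟩,
    ⟨216172782919877192, 18, [5, 6, 7, 8, 9], [3, 5, 8, 11, 16, 21], []⟩,
    ⟨252201579670405704, 19, [], [3, 5, 6, 8, 11],
      [(([0, 2], [0], [0, 1, 0]), [3, 5, 6, 8, 11, 14])]⟩,
    ⟨108086391863509576, 20, [], [], []⟩,
    ⟨18446744075590698632, 10, [], [2], []⟩,
    ⟨9223372054842051208, 29, [], [3, 4, 6, 7, 10],
      [(([0], [0, 1], [0, 2, 1]), [3, 4, 6, 7, 10, 13])]⟩,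
    ⟨27670116112445473416, 28, [], [3, 4, 6, 7, 9],
      [(([0], [0, 2, 1], [0, 1]), [3, 4, 6, 7, 9, 13])]⟩,
    ⟨46116860202261152392, 65, [], [3, 4, 7, 10, 14, 17, 31], []⟩,
    ⟨46116860202261153928, 28, [], [3, 4, 6],
      [(([1, 0], [0], [2]), [3, 4, 6, 7, 10])]⟩,
    ⟨18446744092233698824, 10, [], [2], []⟩,
    ⟨36028937947584008, 9, [], [2, 3, 8], []⟩,
    ⟨144115329004475912, 9, [], [2, 3, 8], []⟩,
    ⟨288230517080331784, 9, [], [2, 3, 8], []⟩,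
    ⟨36029005593318920, 10, [], [3, 6], []⟩,
    ⟨144115396650210824, 10, [], [3, 6], []⟩,
    ⟨288230584726066696, 10, [], [3, 6], []⟩,
    ⟨720646313686894088, 9, [], [3, 5, 8], []⟩,
    ⟨18447025554323473928, 9, [], [2, 3, 4, 9], []⟩,
    ⟨27670397590104507912, 9, [], [3, 4, 7], []⟩,
    ⟨27670116129088473608, 63, [], [3, 5, 6, 8],
      [(([0], [2, 1], [0, 1]), [3, 5, 6, 8, 11])]⟩,
    ⟨55340232239652801032, 9, [], [3, 5, 8], []⟩,
    ⟨27670116129088474120, 10, [], [2], []⟩,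
    ⟨36029006667060232, 30, [], [2], []⟩,
    ⟨144115397723952136, 30, [], [2], []⟩,
    ⟨288230585799808008, 30, [], [2], []⟩,
    ⟨756710294809510920, 45, [], [3, 5, 6, 9, 11, 14, 20, 25, 34],
      [(([0, 1, 0, 1, 2], [0, 1, 0, 1, 2, 0], [0, 1, 0, 1, 2, 0, 1, 2, 0]), [3, 5, 6, 9, 11, 14, 20, 25, 34, 45])]⟩,
    ⟨27670397591178249224, 30, [], [2], []⟩,
    ⟨64563604276507576328, 63, [], [3, 5, 6, 11], []⟩,
    ⟨612599500485214256, 46, [5, 6], [3, 4, 5, 7, 8, 9, 12, 15, 17, 21], []⟩,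
    ⟨144115329004475920, 30, [], [2, 3, 6], []⟩,
    ⟨36029006667059728, 30, [], [3, 4, 6, 7, 13], []⟩,
    ⟨144115397723951632, 30, [], [3, 4, 6, 7, 13], []⟩,
    ⟨288230585799807504, 30, [], [3, 4, 6, 7, 13], []⟩,
    ⟨144115397723952144, 30, [], [2], []⟩,
    ⟨900829876636925968, 45, [5, 6], [3, 4, 5, 7, 8, 9, 12, 15, 17, 21], []⟩,
    ⟨720646313686894112, 9, [], [3, 5, 6, 11], []⟩,
    ⟨756710290782978592, 45, [], [3, 4, 6, 7, 10],
      [(([2], [0, 1], [0, 0, 1]), [3, 4, 6, 7, 10, 13])]⟩,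
    ⟨27670397591178248736, 63, [], [4, 5, 7, 9, 12],
      [(([1, 2], [1, 0], [1, 0, 0]), [4, 5, 7, 9, 12, 16])]⟩,
    ⟨756710294809510944, 45, [], [3, 4, 5, 7, 9],
      [(([2, 0], [1], [0, 1]), [3, 4, 5, 7, 9, 12])]⟩,
    ⟨900829876636925984, 45, [5, 6], [3, 4, 7, 8, 11, 15], []⟩,
    ⟨590909531361051246624, 45, [5, 6], [3, 4, 5, 6, 7, 9, 11, 12, 13, 16, 20], []⟩,
    ⟨27670116129356909184, 9, [], [4, 5, 6],
      [(([0], [1], [0, 2, 1]), [4, 5, 6, 9, 11])]⟩,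
    ⟨55340232239921236608, 11, [], [3, 5, 6, 9, 11, 14],
      [(([1, 0], [1, 0, 0, 2], [1, 0, 2]), [3, 5, 6, 9, 11, 14, 20])]⟩,
    ⟨64563604276776010368, 64, [], [3, 4, 6, 7, 9, 13],
      [(([1, 0], [2], [1, 0, 0, 2]), [3, 4, 6, 7, 9, 13, 16])]⟩,
    ⟨64563604276776011904, 64, [], [3, 4, 5],
      [(([1], [0], [0, 2]), [3, 4, 5, 7, 9])]⟩,
    ⟨720646322008919040, 10, [], [3, 4, 5],
      [(([1], [0], [2, 0]), [3, 4, 5, 7, 9])]⟩,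
    ⟨1873638191066023936, 20, [], [2], []⟩,
    ⟨1873708559809153024, 11, [], [3, 4],
      [(([0], [1], [2]), [3, 4, 5, 7])]⟩]

/-- Search data for the sets of factors of length 2, up to renaming the letters. -/
def branches2 : List Branch :=
  [⟨31, 2, []⟩,
    ⟨47, 2, []⟩,
    ⟨79, 1, [1, 2, 3, 4, 5, 6, 7, 8, 9, 11]⟩,
    ⟨143, 1, [1, 2, 3, 4, 5, 6, 7, 8, 9, 10, 11]⟩,
    ⟨271, 8, [1]⟩,
    ⟨55, 2, []⟩,
    ⟨151, 4, [1]⟩,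
    ⟨279, 4, [1]⟩,
    ⟨167, 5, [2]⟩,
    ⟨91, 6, [1, 2, 3, 4, 6, 7]⟩,
    ⟨283, 8, [1]⟩,
    ⟨107, 0, [1, 2, 3, 4, 5, 6, 7, 8, 9, 10, 11]⟩,
    ⟨171, 5, [1, 2, 3, 4, 5, 7, 8, 9, 12]⟩,
    ⟨299, 8, [1]⟩,
    ⟨203, 0, [1, 2, 3]⟩,
    ⟨331, 0, [1, 2, 3]⟩,
    ⟨395, 0, [1, 2, 3]⟩,
    ⟨115, 4, [1, 3, 4, 5, 7, 8, 9]⟩,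
    ⟨307, 8, [1]⟩,
    ⟨211, 4, [1]⟩,
    ⟨403, 4, [1]⟩,
    ⟨227, 7, [1, 2, 3, 4, 5, 6, 7, 11]⟩,
    ⟨233, 0, [1]⟩,
    ⟨110, 2, [2, 3, 4, 5, 7, 9, 12]⟩]

theorem nodes6_check : nodes6.all (Node.check 6) = true := by decide +kernel

theorem branches4_check : branches4.all (Branch.check 4 6 (nodes6.map Node.S)) = true := by
  decide +kernel

theorem nodes4_check : nodes4.all (Node.check 4) = true := by decide +kernel

theorem branches2_check :
    branches2.all (Branch.check 2 4 (nodes4.map Node.S ++ branches4.map Branch.S)) = true := by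
  decide +kernel

/-! ### Renaming the letters -/

/-- The permutations of the alphabet. -/
def renamings : List (Fin 3 → Fin 3) :=
  [![0, 1, 2], ![0, 2, 1], ![1, 0, 2], ![1, 2, 0], ![2, 0, 1], ![2, 1, 0]]

/-- The effect of renaming the letters on the code `3 * a + b` of a word of length 2. -/
def rename (s : Fin 3 → Fin 3) (a b : Fin 3) : ℕ := 3 * (s a).val + (s b).val

/-- Every set of 5 words of length 2 is equivalent to one for which there are search data. -/
def renameCheck (B : ℕ) : Bool :=
  !Nat.beq ((List.range 9).filter (tb B)).length 5 || renamings.any fun s =>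
    branches2.any fun e => Nat.ble e.S 511 && [0, 1, 2].all fun a => [0, 1, 2].all fun b =>
      tb e.S (rename s a b) == tb B (3 * a.val + b.val)

theorem renameCheck_all : (List.range 512).all renameCheck = true := by decide +kernel

theorem injective_of_mem_renamings : ∀ s ∈ renamings, Function.Injective s := by decide

theorem ncard_range_congr {F F' : ℕ → ℕ} (h : ∀ i j, F i = F j ↔ F' i = F' j) :
    (Set.range F).ncard = (Set.range F').ncard := by
  have h' : ∀ i, F' (Function.invFun F (F i)) = F' i := fun i =>
    (h _ _).1 (Function.invFun_eq ⟨i, rfl⟩)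
  have key : Set.range F' = (fun x => F' (Function.invFun F x)) '' Set.range F := by
    rw [← Set.range_comp]
    exact congrArg Set.range (funext fun i => (h' i).symm)
  rw [key, Set.InjOn.ncard_image]
  rintro _ ⟨i, rfl⟩ _ ⟨j, rfl⟩ hij
  dsimp only at hij
  rw [h', h'] at hij
  exact (h i j).2 hij

theorem Adm.comp {w : InfWord} (hw : Adm w) {s : Fin 3 → Fin 3} (hs : Function.Injective s) :
    Adm (s ∘ w) where
  card n := by
    rw [← hw.card n]
    refine ncard_range_congr fun i j => ?_
    simp only [code_eq_code_iff, Function.comp_apply, hs.eq_iff]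
  nopow i p k hp hk h := hw.nopow i p k hp hk fun t ht => hs (h t ht)

theorem lt_of_tb {B x n : ℕ} (hB : B < 2 ^ n) (h : tb B x = true) : x < n := by
  by_contra hn
  rw [tb_eq_testBit, Nat.testBit_lt_two_pow
    (hB.trans_le (Nat.pow_le_pow_right (by decide) (not_lt.1 hn)))] at h
  exact Bool.false_ne_true h

theorem exists_full (w : InfWord) : ∃ B < 512, Full w 2 B := by
  classical
  refine ⟨Nat.ofBits fun x : Fin 9 => decide (x.val ∈ codeSet w 2), Nat.ofBits_lt_two_pow _,
    fun x => ?_⟩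
  rw [tb_eq_testBit]
  by_cases hx : x < 9
  · rw [Nat.testBit_ofBits_lt _ _ hx, decide_eq_true_eq]
  · rw [Nat.testBit_ofBits_ge _ _ (not_lt.1 hx)]
    simp only [Bool.false_eq_true, iff_false]
    rintro ⟨i, rfl⟩
    exact hx (code_lt w i 2)

theorem code_two (w : InfWord) (i : ℕ) : code w i 2 = 3 * (w i).val + (w (i + 1)).val := by
  simp [code]

theorem exists_renaming {w : InfWord} (hw : Adm w) :
    ∃ s : Fin 3 → Fin 3, Function.Injective s ∧ ∃ e ∈ branches2, Full (s ∘ w) 2 e.S := by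
  obtain ⟨B, hB, hfull⟩ := exists_full w
  have hc := List.all_eq_true.1 renameCheck_all B (List.mem_range.2 hB)
  have hcard : ((List.range 9).filter (tb B)).length = 5 := by
    have h : codeSet w 2 = ((Finset.range 9).filter fun x => tb B x = true : Finset ℕ) := by
      ext x
      rw [hfull]
      simpa using fun h => lt_of_tb (n := 9) hB h
    have h' := hw.card 2
    rw [h, Set.ncard_coe_finset] at h'
    simpa [Finset.card, Finset.range, Multiset.range] using h'
  rw [renameCheck, hcard] at hc
  simp only [Nat.beq, Bool.not_true, Bool.false_or, List.any_eq_true, List.all_eq_true,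
    Bool.and_eq_true, Nat.ble_eq, beq_iff_eq] at hc
  obtain ⟨s, hs, e, he, hS, hall⟩ := hc
  have hinj := injective_of_mem_renamings s hs
  have hall' : ∀ a b : Fin 3, tb e.S (rename s a b) = tb B (3 * a.val + b.val) := fun a b =>
    hall a (by fin_cases a <;> simp) b (by fin_cases b <;> simp)
  refine ⟨s, hinj, e, he, fun x => ⟨?_, fun hx => ?_⟩⟩
  · rintro ⟨i, rfl⟩
    have := hall' (w i) (w (i + 1))
    rw [← code_two, (hfull _).1 ⟨i, rfl⟩] at this
    dsimp only
    rw [code_two]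
    exact this
  · have hx9 : x < 9 := lt_of_tb (lt_of_le_of_lt hS (by norm_num)) hx
    have hsurj := Finite.surjective_of_injective hinj
    obtain ⟨a, ha⟩ := hsurj ⟨x / 3, by omega⟩
    obtain ⟨b, hb⟩ := hsurj ⟨x % 3, by omega⟩
    have hxe : x = rename s a b := by
      rw [rename, ha, hb]
      dsimp only
      omega
    rw [hxe, hall'] at hx
    obtain ⟨i, hi⟩ := (hfull _).2 hx
    refine ⟨i, ?_⟩
    dsimp only at hi ⊢
    rw [code_two] at hi
    have hab : w i = a ∧ w (i + 1) = b := by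
      constructor <;> ext <;> omega
    rw [hxe, code_two, rename, ← hab.1, ← hab.2]
    rfl

theorem exists_decoded {w : InfWord} (hw : Adm w) :
    ∃ s : Fin 3 → Fin 3, Function.Injective s ∧ Decoded (s ∘ w) := by
  obtain ⟨s, hs, e, he, hfull⟩ := exists_renaming hw
  have hw' := hw.comp hs
  refine ⟨s, hs, ?_⟩
  obtain ⟨B, hB, hfull⟩ := full_of_check hw' hfull (List.all_eq_true.1 branches2_check e he)
  rw [List.mem_append, List.mem_map, List.mem_map] at hB
  rcases hB with ⟨e, he, rfl⟩ | ⟨e, he, rfl⟩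
  · exact decoded_of_check hw' hfull (List.all_eq_true.1 nodes4_check e he)
  · obtain ⟨B, hB, hfull⟩ := full_of_check hw' hfull (List.all_eq_true.1 branches4_check e he)
    obtain ⟨e, he, rfl⟩ := List.mem_map.1 hB
    exact decoded_of_check hw' hfull (List.all_eq_true.1 nodes6_check e he)

/-! ### Iterated decoding -/

/-- The image of a word under the composition of `h` with the `k`-th power of `gam`. -/
def img' (h : Fin 3 → Word) (k : ℕ) (u : Word) : Word := applyM h ((applyM gam)^[k] u)

theorem applyM_iterate_append (f : Fin 3 → Word) (k : ℕ) (u v : Word) :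
    (applyM f)^[k] (u ++ v) = (applyM f)^[k] u ++ (applyM f)^[k] v := by
  induction k generalizing u v with
  | zero => rfl
  | succ k ih => rw [Function.iterate_succ_apply, applyM_append, ih]; rfl

theorem img'_append (h : Fin 3 → Word) (k : ℕ) (u v : Word) :
    img' h k (u ++ v) = img' h k u ++ img' h k v := by
  rw [img', applyM_iterate_append, applyM_append]; rfl

theorem img'_applyM_gam (h : Fin 3 → Word) (k : ℕ) (u : Word) :
    img' h k (applyM gam u) = img' h (k + 1) u := rfl

theorem img'_eq_applyM (h : Fin 3 → Word) (k : ℕ) (u : Word) :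
    img' h k u = applyM (fun x => img' h k [x]) u := by
  induction u with
  | nil =>
    induction k with
    | zero => rfl
    | succ k ih => rw [← img'_applyM_gam, applyM_nil, ih]; rfl
  | cons a u ih => rw [applyM_cons, ← ih, ← img'_append]; rfl

theorem img'_three (h : Fin 3 → Word) (x : Fin 3) : img' h 3 [x] = img h x := by
  rw [img', img]
  congr 1
  fin_cases x <;> rfl

theorem img'_ne_nil {h : Fin 3 → Word} (hh : ∀ x, h x ≠ []) (k : ℕ) (x : Fin 3) :
    img' h k [x] ≠ [] := by
  induction k generalizing x with
  | zero => simpa [img', applyM] using hh x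
  | succ k ih =>
    have hg : ∃ a v, applyM gam [x] = a :: v := by
      fin_cases x <;> exact ⟨_, _, rfl⟩
    obtain ⟨a, v, hv⟩ := hg
    rw [← img'_applyM_gam, hv, ← List.singleton_append, img'_append]
    simp [ih a]

theorem length_applyM (f : Fin 3 → Word) (u : Word) :
    (applyM f u).length =
      u.count 0 * (f 0).length + u.count 1 * (f 1).length + u.count 2 * (f 2).length := by
  induction u with
  | nil => simp
  | cons a u ih =>
    rw [applyM_cons, List.length_append, ih]
    fin_cases a <;> simp <;> ring

theorem Adm.not_isFactor {w : InfWord} (hw : Adm w) {A B R T V U : Word} (hR : R ≠ [])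
    (hV : V = R ++ U) (hV' : V = U ++ T) (hlen : 2481 * R.length ≤ 1000 * V.length) :
    ¬ IsFactor (A ++ V ++ B) w := by
  intro hf
  obtain ⟨i, hi⟩ := isFactor_iff.1 hf.of_append
  refine hw.nopow i R.length V.length (List.length_pos_iff.2 hR) hlen ?_
  have h₁ := hi
  rw [hV, fac_append_iff] at h₁
  rw [hV', fac_append_iff] at hi
  have h₂ := fac_eq_fac_iff.1 (hi.1.trans h₁.2.symm)
  intro t ht
  rw [h₂ t (by rw [hV, List.length_append] at ht; omega)]
  congr 1
  omega

/-- `v` contains a repetition which is too long under all morphisms. -/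
def hasPower (v : Word) (i p n : ℕ) : Bool :=
  let V := (v.drop i).take n
  V.take (n - p) == V.drop p && [0, 1, 2].all fun x =>
    decide (2481 * (V.take p).count x ≤ 1000 * V.count x) && V.take p != []

theorem Adm.not_isFactor_applyM {w : InfWord} (hw : Adm w) {f : Fin 3 → Word}
    (hf : ∀ x, f x ≠ []) {v : Word} (i p n : ℕ) (hv : hasPower v i p n = true) :
    ¬ IsFactor (applyM f v) w := by
  set V := (v.drop i).take n with hV
  simp only [hasPower, ← hV, Bool.and_eq_true, beq_iff_eq, List.all_cons, decide_eq_true_eq,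
    List.all_nil, bne_iff_ne, ne_eq, and_true] at hv
  obtain ⟨hU, ⟨h0, hne⟩, ⟨h1, -⟩, h2, -⟩ := hv
  have e₁ : v = v.take i ++ V ++ (v.drop i).drop n := by
    rw [List.append_assoc, hV, List.take_append_drop, List.take_append_drop]
  rw [e₁, applyM_append, applyM_append]
  refine hw.not_isFactor (R := applyM f (V.take p)) (U := applyM f (V.drop p))
    (T := applyM f (V.drop (n - p))) ?_ ?_ ?_ ?_
  · obtain ⟨a, u, hu⟩ := List.exists_cons_of_ne_nil hne
    rw [hu, applyM_cons]
    simp [hf a]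
  · rw [← applyM_append, List.take_append_drop]
  · rw [← hU, ← applyM_append, List.take_append_drop]
  · rw [length_applyM, length_applyM]
    nlinarith [Nat.mul_le_mul_right (f 0).length h0, Nat.mul_le_mul_right (f 1).length h1,
      Nat.mul_le_mul_right (f 2).length h2]

theorem img'_add (h : Fin 3 → Word) (j k : ℕ) (u : Word) :
    img' h (j + k) u = applyM (fun x => img' h j [x]) ((applyM gam)^[k] u) := by
  rw [← img'_eq_applyM, img', img', Function.iterate_add_apply]

theorem Adm.not_isFactor_img' {w : InfWord} (hw : Adm w) {h : Fin 3 → Word}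
    (hh : ∀ x, h x ≠ []) {k : ℕ} (hk : 4 ≤ k) {v : Word} (i p n : ℕ)
    (hv : hasPower ((applyM gam)^[4] v) i p n = true) : ¬ IsFactor (img' h k v) w := by
  obtain ⟨j, rfl⟩ := Nat.exists_eq_add_of_le' hk
  rw [img'_add]
  exact hw.not_isFactor_applyM (img'_ne_nil hh j) i p n hv

/-- The first letter of the preimage under `gam` of a word beginning with `a b`. -/
def preLetter (a b : Fin 3) : Fin 3 := if a = 2 then 1 else if b = 1 then 0 else 2

/-- A word with only allowed pairs whose factors have their images in `w`. -/
def DecodedBy (w : InfWord) (h : Fin 3 → Word) (k : ℕ) : Prop :=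
  ∃ y : InfWord, (∀ n, (y n, y (n + 1)) ∈ pairs) ∧ ∀ u, IsFactor u y → IsFactor (img' h k u) w

set_option synthInstance.maxSize 1000 in
theorem exists_preimage {y : InfWord} (hy : ∀ n, (y n, y (n + 1)) ∈ pairs) :
    ∃ z : InfWord, (∀ n, (z n, z (n + 1)) ∈ (0, 0) :: (2, 2) :: pairs) ∧
      ∀ u, IsFactor u z → IsFactor (applyM gam u) y := by
  let c : ℕ → ℕ := fun n => Nat.rec (if y 0 = 1 then 1 else 0)
    (fun _ c => c + (gam (preLetter (y c) (y (c + 1)))).length) n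
  have hc : ∀ n, c (n + 1) = c n + (gam (preLetter (y (c n)) (y (c n + 1)))).length :=
    fun _ => rfl
  have hc1 : ∀ n, y (c n) ≠ 1 := by
    intro n
    induction n with
    | zero =>
      have key : ∀ a b : Fin 3, (a, b) ∈ pairs → a = 1 → b ≠ 1 := by decide
      by_cases h0 : y 0 = 1
      · simpa [c, h0] using key _ _ (hy 0) h0
      · simp [c, h0]
    | succ n ih =>
      rw [hc]
      have key : ∀ a b d : Fin 3, (a, b) ∈ pairs ∧ (b, d) ∈ pairs ∧ a ≠ 1 →
          ((gam (preLetter a b)).length = 1 ∧ b ≠ 1) ∨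
          ((gam (preLetter a b)).length = 2 ∧ d ≠ 1) := by decide
      rcases key _ _ _ ⟨hy (c n), hy (c n + 1), ih⟩ with ⟨h, h'⟩ | ⟨h, h'⟩ <;> rw [h] <;> exact h'
  refine ⟨fun n => preLetter (y (c n)) (y (c n + 1)), fun n => ?_, fun u hu => ?_⟩
  · have key : ∀ a b d e : Fin 3, (a, b) ∈ pairs ∧ (b, d) ∈ pairs ∧ (d, e) ∈ pairs ∧ a ≠ 1 →
        ((gam (preLetter a b)).length = 1 ∧
          (preLetter a b, preLetter b d) ∈ (0, 0) :: (2, 2) :: pairs) ∨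
        ((gam (preLetter a b)).length = 2 ∧
          (preLetter a b, preLetter d e) ∈ (0, 0) :: (2, 2) :: pairs) := by decide
    dsimp only
    rcases key _ _ _ _ ⟨hy (c n), hy (c n + 1), hy (c n + 2), hc1 n⟩ with ⟨h, h'⟩ | ⟨h, h'⟩ <;>
      rw [hc, h] <;> exact h'
  · refine isFactor_applyM (pos := c) hc (fun n => ?_) hu
    have key : ∀ a b : Fin 3, (a, b) ∈ pairs → a ≠ 1 →
        gam (preLetter a b) = [a] ∨ gam (preLetter a b) = [a, b] := by decide
    rcases key _ _ (hy (c n)) (hc1 n) with h | h <;> simp [h, fac, List.range_succ]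

theorem DecodedBy.succ {w : InfWord} (hw : Adm w) {h : Fin 3 → Word} (hh : ∀ x, h x ≠ []) {k : ℕ}
    (hk : 3 ≤ k) (hd : DecodedBy w h k) : DecodedBy w h (k + 1) := by
  obtain ⟨y, hy, hyw⟩ := hd
  obtain ⟨z, hz, hzy⟩ := exists_preimage hy
  have hzw : ∀ u, IsFactor u z → IsFactor (img' h (k + 1) u) w := fun u hu =>
    hyw _ (hzy u hu)
  have h3 : ∀ n, IsFactor (img' h (k + 1) [z n, z (n + 1), z (n + 2)]) w := fun n => by
    have := hzw _ (isFactor_fac z n 3)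
    simpa [fac, List.range_succ] using this
  refine ⟨fun n => z (n + 1), fun n => ?_, fun u hu => hzw u ?_⟩
  · have hpow : ∀ v i p n, hasPower ((applyM gam)^[4] v) i p n = true →
      ¬ IsFactor (img' h (k + 1) v) w := fun v i p n => hw.not_isFactor_img' hh (by omega) i p n
    have hz1 := hz (n + 1)
    rw [List.mem_cons, List.mem_cons, Prod.mk.injEq, Prod.mk.injEq] at hz1
    rcases hz1 with ⟨h0, h0'⟩ | ⟨h2, h2'⟩ | hp
    · have h := h3 n
      rw [h0, h0'] at h
      exfalso
      generalize z n = a at h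
      fin_cases a
      · exact hpow [0, 0, 0] 0 9 27 (by decide) h
      · exact hpow [1, 0, 0] 2 9 23 (by decide) h
      · exact hpow [2, 0, 0] 7 9 23 (by decide) h
    · have h := h3 (n + 1)
      have hz' := hz (n + 2)
      rw [h2, h2'] at h
      rw [h2'] at hz'
      exfalso
      generalize z (n + 1 + 2) = a at h hz'
      fin_cases a
      · exact hpow [2, 2, 0] 0 12 31 (by decide) h
      · revert hz'
        decide
      · exact hpow [2, 2, 2] 0 12 36 (by decide) h
    · exact hp
  · obtain ⟨i, hi⟩ := isFactor_iff.1 hu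
    refine isFactor_iff.2 ⟨i + 1, hi ▸ ?_⟩
    rw [length_fac, fac_eq_fac_iff]
    intro t _
    congr 1
    omega

theorem exists_decodedBy {w : InfWord} (hw : Adm w) (hd : Decoded w) :
    ∃ h : Fin 3 → Word, (∀ x, h x ≠ []) ∧ ∀ k, 3 ≤ k → DecodedBy w h k := by
  obtain ⟨h, hh, y, hy, hyw⟩ := hd
  refine ⟨h, hh, fun k hk => ?_⟩
  induction k, hk using Nat.le_induction with
  | base =>
    refine ⟨y, hy, fun u hu => ?_⟩
    rw [img'_eq_applyM, funext (img'_three h)]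
    exact hyw u hu
  | succ k hk ih => exact ih.succ hw hh hk

/-! ### Long repetitions -/

theorem img'_factor_of_append {w : InfWord} {h : Fin 3 → Word} {k : ℕ} {a u b : Word}
    (hf : IsFactor (img' h k (a ++ u ++ b)) w) : IsFactor (img' h k u) w := by
  rw [img'_append, img'_append] at hf
  exact hf.of_append

theorem DecodedBy.isFactor_zero {w : InfWord} {h : Fin 3 → Word} {k : ℕ}
    (hd : DecodedBy w h k) : IsFactor (img' h k [0]) w := by
  obtain ⟨y, hy, hyw⟩ := hd
  have key : ∀ a b c : Fin 3, (a, b) ∈ pairs → (b, c) ∈ pairs → a = 0 ∨ b = 0 ∨ c = 0 := by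
    decide
  have h0 : ∃ n, y n = 0 := by
    rcases key _ _ _ (hy 0) (hy 1) with h | h | h <;> exact ⟨_, h⟩
  obtain ⟨n, hn⟩ := h0
  have := hyw _ (isFactor_fac y n 1)
  simpa [fac, List.range_succ, hn] using this

/-- A word containing a long repetition, all whose images are factors. -/
theorem exists_repetition {L : Word → Prop} (h0 : L [0]) (hgam : ∀ u, L u → L (applyM gam u))
    (happ : ∀ a u b, L (a ++ u ++ b) → L u) (h : Fin 3 → Word) (m : ℕ) :
    ∃ R X Y : Word, ∃ a b : Fin 3, L ([a] ++ (R ++ X) ++ [b]) ∧ R ++ X = X ++ Y ∧ R ≠ [] ∧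
      ∀ j, (img' h j R).length = (img' h (j + 2 * m) [2, 0]).length ∧
        (img' h j (R ++ X)).length = ∑ i ∈ Finset.range m, (img' h (j + 2 * i) [2, 0]).length +
          2 * (img' h (j + 2 * m) [2, 0]).length := by
  induction m with
  | zero =>
    refine ⟨[2, 0], [2, 0], [2, 0], 1, 1, ?_, rfl, by simp, fun j => ⟨rfl, ?_⟩⟩
    · exact happ [0] _ [0, 2] (hgam _ (hgam _ (hgam _ (hgam _ h0))))
    · rw [img'_append, List.length_append]
      simp [two_mul]
  | succ m ih =>
    obtain ⟨R, X, Y, a, b, hL, hXY, hR, hlen⟩ := ih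
    have hlast : ∀ a : Fin 3, ∃ p x, applyM gam (applyM gam [a]) = p ++ [x, 2] := by
      intro a
      fin_cases a
      · exact ⟨[0], 1, rfl⟩
      · exact ⟨[], 0, rfl⟩
      · exact ⟨[0, 1], 0, rfl⟩
    have hfirst : ∀ a : Fin 3, ∃ p x, applyM gam (applyM gam [a]) = 0 :: x :: p := by
      intro a
      fin_cases a <;> exact ⟨_, _, rfl⟩
    have hY : Y ≠ [] := by
      rintro rfl
      have := congrArg List.length hXY
      simp only [List.length_append, List.length_nil] at this
      exact hR (List.eq_nil_of_length_eq_zero (by omega))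
    obtain ⟨S, hS⟩ : ∃ S, applyM gam (applyM gam R) = S ++ [2] := by
      obtain ⟨p, x, hp⟩ := hlast (R.getLast hR)
      refine ⟨applyM gam (applyM gam R.dropLast) ++ (p ++ [x]), ?_⟩
      conv_lhs => rw [← List.dropLast_append_getLast hR]
      rw [applyM_append, applyM_append, hp]
      simp
    obtain ⟨Z, hZ⟩ : ∃ Z, applyM gam (applyM gam Y) = 0 :: Z := by
      obtain ⟨y, Y, rfl⟩ := List.exists_cons_of_ne_nil hY
      obtain ⟨p, x, hp⟩ := hfirst y
      refine ⟨x :: p ++ applyM gam (applyM gam Y), ?_⟩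
      rw [← List.singleton_append, applyM_append, applyM_append, hp]
      rfl
    obtain ⟨p, a', hp⟩ := hlast a
    obtain ⟨q, b', hq⟩ := hfirst b
    have hT : (2 :: S) ++ (2 :: applyM gam (applyM gam X) ++ [0]) =
        [2] ++ applyM gam (applyM gam (R ++ X)) ++ [0] := by
      rw [applyM_append, applyM_append, hS]
      simp
    refine ⟨2 :: S, 2 :: applyM gam (applyM gam X) ++ [0], Z ++ [0], a', b', ?_, ?_, by simp,
      fun j => ⟨?_, ?_⟩⟩
    · refine happ p _ q ?_
      have := hgam _ (hgam _ hL)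
      simp only [applyM_append, hp, hq] at this
      rw [hT]
      simpa [applyM_append] using this
    · rw [hT, hXY, applyM_append, applyM_append, hZ]
      simp
    · rw [← List.singleton_append, img'_append, List.length_append, Nat.add_comm,
        ← List.length_append, ← img'_append, ← hS, img'_applyM_gam, img'_applyM_gam, (hlen _).1]
      congr 2
      ring
    · rw [hT, img'_append, img'_append, List.length_append, List.length_append, img'_applyM_gam,
        img'_applyM_gam, (hlen _).2, Finset.sum_range_succ', ← List.singleton_append (l := [0]),
        img'_append h (j + 2 * 0), List.length_append]
      have e : ∀ i, j + 1 + 1 + 2 * i = j + 2 * (i + 1) := fun i => by ring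
      simp only [e, mul_zero, add_zero]
      ring

theorem exists_periods {w : InfWord} (hw : Adm w) (hd : Decoded w) :
    ∃ h : Fin 3 → Word, ∀ m, ∃ i, ∀ t, 0 < (img' h (3 + 2 * m) [2, 0]).length ∧
      (t + (img' h (3 + 2 * m) [2, 0]).length <
        ∑ i ∈ Finset.range m, (img' h (3 + 2 * i) [2, 0]).length +
          2 * (img' h (3 + 2 * m) [2, 0]).length →
      w (i + t) = w (i + t + (img' h (3 + 2 * m) [2, 0]).length)) := by
  obtain ⟨h, hh, hd⟩ := exists_decodedBy hw hd
  refine ⟨h, fun m => ?_⟩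
  obtain ⟨R, X, Y, a, b, hL, hXY, hR, hlen⟩ := exists_repetition
    (L := fun u => ∀ k, 3 ≤ k → IsFactor (img' h k u) w)
    (fun k hk => (hd k hk).isFactor_zero) (fun u hu k hk => hu (k + 1) (by omega))
    (fun a u b hu k hk => img'_factor_of_append (hu k hk)) h m
  obtain ⟨i, hi⟩ := isFactor_iff.1 (img'_factor_of_append (hL 3 le_rfl))
  have hi' := hi
  rw [hXY, img'_append, fac_append_iff] at hi'
  have hn := (hlen 3).2
  rw [img'_append, fac_append_iff] at hi
  rw [img'_append, List.length_append] at hn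
  refine ⟨i, fun t => ?_⟩
  rw [← hn, ← (hlen 3).1]
  constructor
  · obtain ⟨x, R, rfl⟩ := List.exists_cons_of_ne_nil hR
    rw [← List.singleton_append, img'_append, List.length_append]
    have := List.length_pos_iff.2 (img'_ne_nil hh 3 x)
    omega
  · intro ht
    rw [fac_eq_fac_iff.1 (hi'.1.trans hi.2.symm) t (by omega)]
    congr 1
    omega

/-! ### Growth -/

/-- The weights of the letters in an eigenvector of `gam`. -/
noncomputable def weight (lam : ℝ) : Fin 3 → ℝ := ![1, lam - 1, lam ^ 2 - lam]

theorem sum_weight_applyM {lam : ℝ} (hlam : lam ^ 3 - 2 * lam ^ 2 + lam - 1 = 0) (u : Word) :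
    ((applyM gam u).map (weight lam)).sum = lam * (u.map (weight lam)).sum := by
  induction u with
  | nil => simp
  | cons a u ih =>
    rw [applyM_cons, List.map_append, List.sum_append, ih, List.map_cons, List.sum_cons, mul_add]
    congr 1
    fin_cases a <;> simp [gam, weight] <;> linarith

theorem length_img'_le {lam : ℝ} (hlam : lam ^ 3 - 2 * lam ^ 2 + lam - 1 = 0) (hl : 3 / 2 ≤ lam)
    (h : Fin 3 → Word) : ∃ C : ℝ, ∀ k, ((img' h k [2, 0]).length : ℝ) ≤ C * lam ^ k := by
  have hle : ∀ u, ((applyM h u).length : ℝ) ≤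
      2 * ((h 0).length + (h 1).length + (h 2).length) * (u.map (weight lam)).sum := by
    intro u
    induction u with
    | nil => simp
    | cons a u ih =>
      rw [applyM_cons, List.length_append, Nat.cast_add, List.map_cons, List.sum_cons, mul_add]
      refine add_le_add ?_ ih
      have hw : 1 / 2 ≤ weight lam a := by
        fin_cases a <;> simp [weight] <;> nlinarith
      have ha : ((h a).length : ℝ) ≤ (h 0).length + (h 1).length + (h 2).length := by
        norm_cast
        fin_cases a <;> simp <;> omega
      have : (0 : ℝ) ≤ (h a).length := by positivity
      nlinarith
  have hpow : ∀ k u, (((applyM gam)^[k] u).map (weight lam)).sum =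
      lam ^ k * (u.map (weight lam)).sum := by
    intro k
    induction k with
    | zero => simp
    | succ k ih =>
      intro u
      rw [Function.iterate_succ_apply, ih, sum_weight_applyM hlam]
      ring
  refine ⟨2 * ((h 0).length + (h 1).length + (h 2).length) *
    (([2, 0] : Word).map (weight lam)).sum, fun k => (hle _).trans_eq ?_⟩
  rw [hpow]
  ring

theorem lt_of_cubic {lam : ℝ} (hlam : lam ^ 3 - 2 * lam ^ 2 + lam - 1 = 0) : 1.7548 < lam := by
  by_contra! hl
  norm_num at hl
  have e : lam * (lam - 1) ^ 2 = 1 := by linarith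
  have hpos : 0 < lam := by
    by_contra! h
    nlinarith [sq_nonneg (lam - 1)]
  rcases le_total lam 1 with h | h
  · nlinarith [mul_nonneg hpos.le (sub_nonneg.2 h)]
  · have h2 : (lam - 1) ^ 2 ≤ (0.7548 : ℝ) ^ 2 := pow_le_pow_left₀ (by linarith) (by linarith) 2
    nlinarith

theorem growth_contradiction {a : ℕ → ℝ} {l C θ : ℝ} (hl : 1 < l) (hθ : θ < 1 / (l - 1))
    (h0 : 1 ≤ a 0) (hC : ∀ m, a m ≤ C * l ^ m)
    (hS : ∀ m, ∑ i ∈ Finset.range m, a i ≤ θ * a m) (hpos : ∀ m, 0 < a m) : False := by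
  have hθ0 : 0 < θ := by
    have := hS 1
    simp only [Finset.range_one, Finset.sum_singleton] at this
    by_contra! h
    nlinarith [hpos 1]
  have hρ : l < 1 + 1 / θ := by
    rw [lt_div_iff₀ (by linarith)] at hθ
    have : l - 1 < 1 / θ := by
      rw [lt_div_iff₀ hθ0]
      linarith
    linarith
  have hgrow : ∀ m, (1 + 1 / θ) ^ m ≤ ∑ i ∈ Finset.range (m + 1), a i := by
    intro m
    induction m with
    | zero => simpa using h0
    | succ m ih =>
      rw [Finset.sum_range_succ, pow_succ]
      have h1 := hS (m + 1)
      have h2 : (∑ i ∈ Finset.range (m + 1), a i) * (1 / θ) ≤ a (m + 1) := by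
        rw [mul_one_div, div_le_iff₀ hθ0]
        linarith
      have h3 : 0 < 1 / θ := by positivity
      nlinarith
  obtain ⟨m, hm⟩ := pow_unbounded_of_one_lt (θ * C * l) ((one_lt_div (by linarith)).2 hρ)
  rw [div_pow, lt_div_iff₀ (by positivity)] at hm
  have h1 := hgrow m
  have h2 := hS (m + 1)
  have h3 := mul_le_mul_of_nonneg_left (hC (m + 1)) hθ0.le
  rw [pow_succ] at h3
  linarith

theorem le_mul_of_period {w : InfWord} {x : ℝ}
    (hx : ∀ u : Word, u ≠ [] → IsFactor u w → expo u ≤ x) {i p n : ℕ} (hp : 1 ≤ p) (hn : 1 ≤ n)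
    (h : ∀ t, t + p < n → w (i + t) = w (i + t + p)) : (n : ℝ) ≤ x * p := by
  have hu := hx (fac w i n) (by rwa [← List.length_pos_iff, length_fac]) (isFactor_fac w i n)
  have hper : HasPeriod (fac w i n) p := by
    refine ⟨hp, fun t ht => ?_⟩
    rw [length_fac] at ht
    have ht' : t < n := by omega
    simp [fac, ht, ht', h t ht, Nat.add_assoc]
  have hle : minPeriod (fac w i n) ≤ p := Nat.sInf_le hper
  have hmin : 1 ≤ minPeriod (fac w i n) := (Nat.sInf_mem (s := {p | HasPeriod (fac w i n) p}) ⟨p, hper⟩).1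
  have hpos : (0 : ℝ) < minPeriod (fac w i n) := by exact_mod_cast hmin
  rw [expo, length_fac] at hu
  have hx0 : 0 ≤ x := le_trans (by positivity) hu
  rw [div_le_iff₀ hpos] at hu
  exact hu.trans (mul_le_mul_of_nonneg_left (by exact_mod_cast hle) hx0)

theorem adm_of_expo_le {w : InfWord} (hc : ∀ n, complexity w n = 2 * n + 1) {x : ℝ}
    (hx : ∀ u : Word, u ≠ [] → IsFactor u w → expo u ≤ x) (hx' : x < 2.481) : Adm w where
  card n := (ncard_codeSet w n).trans (hc n)
  nopow i p k hp hk h := by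
    have h1 := le_mul_of_period hx hp (by omega : 1 ≤ k) h
    have h2 : (2481 * p : ℝ) ≤ 1000 * k := by exact_mod_cast hk
    have h3 : (1 : ℝ) ≤ p := by exact_mod_cast hp
    norm_num at hx'
    nlinarith

/-- If an infinite word over Σ₃ has factor complexity `2n+1` for every `n`, then its
critical exponent (the supremum of exponents of its nonempty factors) is at least
`μ = 2 + 1/(λ² - 1)`, where `λ` is the real zero of `x³ - 2x² + x - 1`. -/
theorem stmt0 (w : InfWord) (hc : ∀ n : ℕ, complexity w n = 2 * n + 1)
    (lam : ℝ) (hlam : lam ^ 3 - 2 * lam ^ 2 + lam - 1 = 0) :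
    ∀ x : ℝ, x < 2 + 1 / (lam ^ 2 - 1) →
      ∃ u : Word, u ≠ [] ∧ IsFactor u w ∧ x < expo u := by
  intro x hxlam
  by_contra! hx
  have hl := lt_of_cubic hlam
  have hl2 : 3.0793 < lam ^ 2 := by
    norm_num at hl ⊢
    nlinarith
  norm_num at hl hl2
  have hx' : x < 2.481 := by
    have h : 1 / (lam ^ 2 - 1) < 0.481 := by
      rw [div_lt_iff₀ (by linarith)]
      norm_num
      linarith
    norm_num only at h ⊢
    linarith
  have hw := adm_of_expo_le hc hx hx'
  obtain ⟨s, hs, hd⟩ := exists_decoded hw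
  obtain ⟨h, hh⟩ := exists_periods (hw.comp hs) hd
  obtain ⟨C, hC⟩ := length_img'_le hlam (by linarith) h
  have hpos : ∀ m, 0 < (img' h (3 + 2 * m) [2, 0]).length := fun m => by
    obtain ⟨i, hi⟩ := hh m
    exact (hi 0).1
  refine growth_contradiction (a := fun m => ((img' h (3 + 2 * m) [2, 0]).length : ℝ))
    (l := lam ^ 2) (C := C * lam ^ 3) (θ := x - 2) (by linarith) (by linarith)
    (by exact_mod_cast hpos 0) (fun m => ?_) (fun m => ?_) (fun m => by exact_mod_cast hpos m)
  · refine (hC _).trans_eq ?_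
    rw [pow_add, pow_mul]
    ring
  · obtain ⟨i, hi⟩ := hh m
    have := le_mul_of_period hx (hpos m) (by have := hpos m; omega)
      fun t ht => hs ((hi t).2 ht)
    push_cast at this
    linarith
end

section
/- Let w : ℕ → Σ₃ be an infinite word containing no factor of exponent 5/2 or greater, and suppose w = g(u) for some infinite word u : ℕ → Σ₃, where g = [a,b,c] with a, b, c nonempty finite words satisfying: (i) b is a prefix of a and a is a prefix of c; (ii) |b| ≥ |c|/2; (iii) b and c have a common suffix s with |s| ≥ |b|/2. Then a final segment of w has the form g(γ²(v)) for some infinite word v; equivalently, a final segment of w has the form g'(v) where g' = c·(g∘γ²)·c⁻¹ = [cab, ca, caba]. Moreover, writing A = g'(0) = cab, B = g'(1) = ca, C = g'(2) = caba, one has: (1) B is a prefix of A and A is a prefix of C; (2) |B| ≥ |C|/2; (3) B and C have a common suffix S with |S| ≥ |B|/2. -/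
lemma imPrefix_succ (f : Sigma3 → Word) (u : InfWord) (k : ℕ) :
    imPrefix f u (k + 1) = imPrefix f u k ++ f (u k) := by
  simp [imPrefix, applyM, List.range_succ]

lemma imPrefix_prefix (f : Sigma3 → Word) (u : InfWord) {k l : ℕ} (h : k ≤ l) :
    imPrefix f u k <+: imPrefix f u l := by
  induction l, h using Nat.le_induction with
  | base => exact List.prefix_rfl
  | succ l _ ih => exact ih.trans (imPrefix_succ f u l ▸ List.prefix_append _ _)

lemma le_length_imPrefix {f : Sigma3 → Word} (hf : ∀ x, f x ≠ []) (u : InfWord) (k : ℕ) :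
    k ≤ (imPrefix f u k).length := by
  induction k with
  | zero => exact Nat.zero_le _
  | succ k ih =>
    have := List.length_pos_iff.2 (hf (u k))
    rw [imPrefix_succ, List.length_append]
    omega

lemma getElem?_eq_of_prefix {p q : Word} (h : p <+: q) {n : ℕ} (hn : n < p.length) :
    p[n]? = q[n]? := by
  obtain ⟨r, rfl⟩ := h
  rw [List.getElem?_append_left hn]

/-- The infinite word `w` extends the finite word `p`. -/
def StartsWith (w : InfWord) (p : Word) : Prop :=
  ∀ n < p.length, p[n]? = some (w n)

lemma StartsWith.of_prefix {w : InfWord} {p q : Word} (h : StartsWith w q) (hpq : p <+: q) :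
    StartsWith w p := by
  intro n hn
  rw [getElem?_eq_of_prefix hpq hn, h n (hn.trans_le hpq.length_le)]

lemma StartsWith.shift {w : InfWord} {p q : Word} (h : StartsWith w (p ++ q)) :
    StartsWith (shift w p.length) q := by
  intro n hn
  have := h (n + p.length) (by simp; omega)
  rwa [List.getElem?_append_right (by omega), Nat.add_sub_cancel] at this

lemma StartsWith.isFactor {w : InfWord} {p x : Word} (h : StartsWith w p) (hx : x <:+: p) :
    IsFactor x w := by
  obtain ⟨l, r, rfl⟩ := hx
  have h' := (h.of_prefix (List.prefix_append _ _)).shift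
  refine ⟨l.length, List.ext_getElem? fun n => ?_⟩
  by_cases hn : n < x.length
  · rw [h' n hn]
    simp [_root_.shift, hn, Nat.add_comm]
  · simp [hn]

lemma startsWith_applyMInf {f : Sigma3 → Word} (hf : ∀ x, f x ≠ []) (u : InfWord) (k : ℕ) :
    StartsWith (applyMInf f u) (imPrefix f u k) := by
  intro n hn
  have hn' : n < (imPrefix f u (n + 1)).length := le_length_imPrefix hf u (n + 1)
  have hk : (imPrefix f u (n + 1))[n]? = (imPrefix f u k)[n]? := by
    rcases le_total k (n + 1) with h | h
    · exact (getElem?_eq_of_prefix (imPrefix_prefix f u h) hn).symm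
    · exact getElem?_eq_of_prefix (imPrefix_prefix f u h) hn'
  rw [← hk]
  simp [applyMInf, hn']

lemma eq_applyMInf {f : Sigma3 → Word} (hf : ∀ x, f x ≠ []) {w v : InfWord}
    (h : ∀ k, StartsWith w (imPrefix f v k)) : w = applyMInf f v := by
  funext n
  have hn : n < (imPrefix f v (n + 1)).length := le_length_imPrefix hf v (n + 1)
  exact Option.some_injective _
    ((h (n + 1) n hn).symm.trans (startsWith_applyMInf hf v (n + 1) n hn))

lemma hasPeriod_of_prefix_append {t x : Word} (ht : t ≠ []) (h : x <+: t ++ x) :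
    HasPeriod x t.length := by
  refine ⟨List.length_pos_iff.2 ht, fun i hi => ?_⟩
  have := getElem?_eq_of_prefix h hi
  rw [List.getElem?_append_right (by omega), Nat.add_sub_cancel] at this
  simp [List.getD_eq_getElem?_getD, this]

lemma NoFiveHalves.two_mul_length_lt {w : InfWord} (hp : NoFiveHalves w) {t x : Word}
    (ht : t ≠ []) (hx : IsFactor x w) (h : x <+: t ++ x) : 2 * x.length < 5 * t.length := by
  have htl := List.length_pos_iff.2 ht
  rcases eq_or_ne x [] with rfl | hx0
  · simpa using htl
  have hper := hasPeriod_of_prefix_append ht h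
  have hmin : minPeriod x ≤ t.length := Nat.sInf_le hper
  have hpos : 1 ≤ minPeriod x := (Nat.sInf_mem (s := {p | HasPeriod x p}) ⟨_, hper⟩).1
  have hexp := hp x hx0 hx
  rw [expo, div_lt_div_iff₀ (by exact_mod_cast hpos) two_pos] at hexp
  have : x.length * 2 < 5 * minPeriod x := by exact_mod_cast hexp
  omega

/-- The blocks of `γ²`. -/
def gamSq : Sigma3 → Word := ![[0, 1, 2], [0, 2], [0, 1, 0, 2]]

/-- The letter whose `γ²`-block starts at position `p` of `u`. -/
def blockLetter (u : InfWord) (p : ℕ) : Sigma3 :=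
  if u (p + 1) = 2 then 1 else if u (p + 2) = 2 then 0 else 2

/-- The starting position of the `j`-th `γ²`-block of `u`, the first one starting at `k`. -/
def blockStart (u : InfWord) (k : ℕ) : ℕ → ℕ
  | 0 => k
  | j + 1 => blockStart u k j + (gamSq (blockLetter u (blockStart u k j))).length

/-- A word avoiding `00`, `11`, `22`, `21` and `0101` has a `γ²`-decomposition after
each occurrence of `2`. -/
lemma exists_gamSq_decomposition {u : InfWord}
    (h00 : ∀ i, ¬ (u i = 0 ∧ u (i + 1) = 0)) (h11 : ∀ i, ¬ (u i = 1 ∧ u (i + 1) = 1))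
    (h22 : ∀ i, ¬ (u i = 2 ∧ u (i + 1) = 2)) (h21 : ∀ i, ¬ (u i = 2 ∧ u (i + 1) = 1))
    (h0101 : ∀ i, ¬ (u i = 0 ∧ u (i + 1) = 1 ∧ u (i + 2) = 0 ∧ u (i + 3) = 1))
    {i : ℕ} (hi : u i = 2) :
    ∃ v : InfWord, ∀ f : Sigma3 → Word, ∀ j, ∃ l,
      imPrefix f u (i + 1) ++ imPrefix (fun x => applyM f (gamSq x)) v j = imPrefix f u l := by
  have trichotomy : ∀ x : Sigma3, x = 0 ∨ x = 1 ∨ x = 2 := by decide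
  have after2 : ∀ m, u m = 2 → u (m + 1) = 0 := fun m hm => by
    have := trichotomy (u (m + 1)); have := h22 m; have := h21 m; tauto
  have step : ∀ (f : Sigma3 → Word) (p : ℕ), u p = 0 →
      let n := p + (gamSq (blockLetter u p)).length
      u n = 0 ∧ imPrefix f u n = imPrefix f u p ++ applyM f (gamSq (blockLetter u p)) := by
    intro f p hp
    have h1 := trichotomy (u (p + 1))
    have h2 := trichotomy (u (p + 2))
    have h3 := trichotomy (u (p + 3))
    by_cases e1 : u (p + 1) = 2
    · simp [blockLetter, gamSq, e1, after2 (p + 1) e1, imPrefix_succ, hp, applyM]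
    have e1' : u (p + 1) = 1 := by have := h00 p; tauto
    by_cases e2 : u (p + 2) = 2
    · simp [blockLetter, gamSq, e1', e2, after2 (p + 2) e2, imPrefix_succ, hp, applyM]
    have e2' : u (p + 2) = 0 := by have := h11 (p + 1); tauto
    have e3 : u (p + 3) = 2 := by have := h00 (p + 2); have := h0101 p; tauto
    simp [blockLetter, gamSq, e1', e2', e3, after2 (p + 3) e3, imPrefix_succ, hp, applyM]
  have start0 : ∀ j, u (blockStart u (i + 1) j) = 0 := by
    intro j
    induction j with
    | zero => exact after2 i hi
    | succ j ih => exact (step (fun _ => []) _ ih).1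
  refine ⟨fun j => blockLetter u (blockStart u (i + 1) j), fun f j =>
    ⟨blockStart u (i + 1) j, ?_⟩⟩
  induction j with
  | zero => simp [imPrefix, applyM, blockStart]
  | succ j ih =>
    rw [imPrefix_succ _ _ j, ← List.append_assoc, ih]
    exact (step f _ (start0 j)).2.symm

lemma imPrefix_conj {f f' : Sigma3 → Word} {c : Word} (h : ∀ x, f' x ++ c = c ++ f x)
    (v : InfWord) (j : ℕ) : imPrefix f' v j ++ c = c ++ imPrefix f v j := by
  induction j with
  | zero => simp [imPrefix, applyM]
  | succ j ih => rw [imPrefix_succ, imPrefix_succ, List.append_assoc, h, ← List.append_assoc, ih,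
      List.append_assoc]

/-- Iteration lemma: under the same hypotheses, with `w = g(u)`, a final segment of `w`
has the form `g(γ²(v))`, equivalently `g'(v)` for the conjugate morphism
`g' = c·(g∘γ²)·c⁻¹ = [cab, ca, caba]`; moreover the three structural conditions hold
again for `A = cab`, `B = ca`, `C = caba`. -/
theorem stmt3 (w : InfWord) (hp : NoFiveHalves w)
    (a b c : Word) (ha : a ≠ []) (hb : b ≠ []) (hc : c ≠ [])
    (u : InfWord) (hw : w = applyMInf ![a, b, c] u)
    (hba : b <+: a) (hac : a <+: c)
    (hlen : c.length ≤ 2 * b.length)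
    (s : Word) (hsb : s <:+ b) (hsc : s <:+ c) (hs : b.length ≤ 2 * s.length) :
    (∃ (k : ℕ) (v : InfWord),
        shift w k =
          applyMInf (fun x => applyM ![a, b, c] (![[0, 1, 2], [0, 2], [0, 1, 0, 2]] x)) v) ∧
    (∃ (k : ℕ) (v : InfWord),
        shift w k = applyMInf ![c ++ a ++ b, c ++ a, c ++ a ++ b ++ a] v) ∧
    (c ++ a) <+: (c ++ a ++ b) ∧
    (c ++ a ++ b) <+: (c ++ a ++ b ++ a) ∧
    (c ++ a ++ b ++ a).length ≤ 2 * (c ++ a).length ∧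
    (∃ S : Word, S <:+ (c ++ a) ∧ S <:+ (c ++ a ++ b ++ a) ∧
      (c ++ a).length ≤ 2 * S.length) := by
  set g : Sigma3 → Word := ![a, b, c] with hg
  have g0 : g 0 = a := rfl
  have g1 : g 1 = b := rfl
  have g2 : g 2 = c := rfl
  have trichotomy : ∀ x : Sigma3, x = 0 ∨ x = 1 ∨ x = 2 := by decide
  have hgne : ∀ x, g x ≠ [] := by
    intro x; rcases trichotomy x with rfl | rfl | rfl <;> assumption
  have hbg : ∀ x, b <+: g x := by
    intro x
    rcases trichotomy x with rfl | rfl | rfl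
    exacts [hba, List.prefix_rfl, hba.trans hac]
  have hblen := hba.length_le
  have halen := hac.length_le
  have hslen := hsb.length_le
  have hstart : ∀ k, StartsWith w (imPrefix g u k) := fun k => hw ▸ startsWith_applyMInf hgne u k
  have hfac : ∀ {x : Word} {k : ℕ}, x <:+: imPrefix g u k → IsFactor x w :=
    fun {_ k} hx => (hstart k).isFactor hx
  have square : ∀ {y z : Word} {k : ℕ}, y ≠ [] → z <+: y → y.length ≤ 2 * z.length →
      ¬ (y ++ y ++ z <:+: imPrefix g u k) := by
    intro y z k hy hz hl hx
    have := hp.two_mul_length_lt hy (hfac hx)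
      (by simpa using hz.trans (List.prefix_append _ _))
    simp only [List.length_append] at this
    omega
  have h00 : ∀ i, ¬ (u i = 0 ∧ u (i + 1) = 0) := by
    rintro i ⟨e0, e1⟩
    obtain ⟨r, hr⟩ := hbg (u (i + 2))
    exact square (k := i + 3) ha hba (by omega)
      ⟨imPrefix g u i, r, by simp [imPrefix_succ, e0, e1, g0, ← hr]⟩
  have h11 : ∀ i, ¬ (u i = 1 ∧ u (i + 1) = 1) := by
    rintro i ⟨e0, e1⟩
    obtain ⟨r, hr⟩ := hbg (u (i + 2))
    exact square (k := i + 3) hb List.prefix_rfl (by omega)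
      ⟨imPrefix g u i, r, by simp [imPrefix_succ, e0, e1, g1, ← hr]⟩
  have h22 : ∀ i, ¬ (u i = 2 ∧ u (i + 1) = 2) := by
    rintro i ⟨e0, e1⟩
    obtain ⟨r, hr⟩ := hbg (u (i + 2))
    exact square (k := i + 3) hc (hba.trans hac) hlen
      ⟨imPrefix g u i, r, by simp [imPrefix_succ, e0, e1, g2, ← hr]⟩
  have h21 : ∀ i, ¬ (u i = 2 ∧ u (i + 1) = 1) := by
    rintro i ⟨e0, e1⟩
    obtain ⟨r, hr⟩ := hbg (u (i + 2))
    obtain ⟨q, hq⟩ := hsc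
    obtain ⟨t, ht⟩ := hsb
    have hx : s ++ b ++ b <:+: imPrefix g u (i + 3) :=
      ⟨imPrefix g u i ++ q, r, by simp [imPrefix_succ, e0, e1, g1, g2, ← hr, ← hq]⟩
    have hlt : (s ++ t).length = b.length := by simp [← ht, Nat.add_comm]
    have := hp.two_mul_length_lt (t := s ++ t)
      (List.length_pos_iff.1 (hlt ▸ List.length_pos_iff.2 hb)) (hfac hx) (by simp [← ht])
    rw [hlt] at this
    simp only [List.length_append] at this
    omega
  have h0101 : ∀ i, ¬ (u i = 0 ∧ u (i + 1) = 1 ∧ u (i + 2) = 0 ∧ u (i + 3) = 1) := by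
    rintro i ⟨e0, e1, e2, e3⟩
    have hag : a <+: g (u (i + 4)) := by
      rcases trichotomy (u (i + 4)) with h | h | h
      · rw [h]; exact List.prefix_rfl
      · exact absurd ⟨e3, h⟩ (h11 (i + 3))
      · rw [h]; exact hac
    obtain ⟨r, hr⟩ := hag
    exact square (k := i + 5) (y := a ++ b) (by simp [ha]) (List.prefix_append _ _)
      (by simp only [List.length_append]; omega)
      ⟨imPrefix g u i, r, by simp [imPrefix_succ, e0, e1, e2, e3, g0, g1, ← hr]⟩
  have hex2 : ∃ i, u i = 2 := by
    by_contra! hno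
    have alt0 : ∀ m, u m = 0 → u (m + 1) = 1 := fun m hm => by
      have := trichotomy (u (m + 1)); have := hno (m + 1); have := h00 m; tauto
    have alt1 : ∀ m, u m = 1 → u (m + 1) = 0 := fun m hm => by
      have := trichotomy (u (m + 1)); have := hno (m + 1); have := h11 m; tauto
    have no0 : ∀ m, u m ≠ 0 := fun m hm =>
      h0101 m ⟨hm, alt0 _ hm, alt1 _ (alt0 _ hm), alt0 _ (alt1 _ (alt0 _ hm))⟩
    rcases trichotomy (u 0) with h | h | h
    exacts [no0 0 h, no0 1 (alt1 0 h), hno 0 h]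
  obtain ⟨i, hi⟩ := hex2
  obtain ⟨v, hv⟩ := exists_gamSq_decomposition h00 h11 h22 h21 h0101 hi
  refine ⟨⟨(imPrefix g u (i + 1)).length, v, eq_applyMInf ?_ fun j => ?_⟩,
    ⟨(imPrefix g u i).length, v, eq_applyMInf ?_ fun j => ?_⟩,
    List.prefix_append _ _, List.prefix_append _ _, ?_, s ++ a, ?_, ?_, ?_⟩
  · intro x
    rcases trichotomy x with rfl | rfl | rfl <;> simp [applyM, g0, ha]
  · obtain ⟨l, hl⟩ := hv g j
    refine StartsWith.shift (p := imPrefix g u (i + 1)) ?_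
    exact (congrArg (StartsWith w) hl).mpr (hstart l)
  · intro x
    rcases trichotomy x with rfl | rfl | rfl <;> simp [hc]
  · obtain ⟨l, hl⟩ := hv g j
    have hconj := imPrefix_conj (f := fun x => applyM g (gamSq x))
      (f' := ![c ++ a ++ b, c ++ a, c ++ a ++ b ++ a]) (c := c)
      (by intro x; rcases trichotomy x with rfl | rfl | rfl <;>
            simp [applyM, gamSq, g0, g1, g2]) v j
    rw [imPrefix_succ, hi, g2, List.append_assoc, ← hconj] at hl
    exact ((hl ▸ hstart l).shift).of_prefix (List.prefix_append _ _)
  · simp only [List.length_append]; omega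
  · obtain ⟨q, rfl⟩ := hsc
    exact ⟨q, by simp⟩
  · obtain ⟨t, rfl⟩ := hsb
    exact ⟨c ++ a ++ t, by simp⟩
  · simp only [List.length_append]; omega
end

section
/- Let w : ℕ → Σ₃ be an infinite word that contains no factor of exponent 5/2 or greater and whose factor complexity equals 2n+1 for every n ≥ 0. Then every final segment of w contains each of the letters 0, 1, and 2 as a factor; equivalently, each letter of Σ₃ occurs infinitely often in w. -/
/-- Read from the least significant bit, the first `k` binary digits of `v` have a prefix of
period `p` and length `⌈5p/2⌉` for some `1 ≤ p ≤ n`. -/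
def startsWithPower (k v : ℕ) : ℕ → Bool
  | 0 => false
  | p + 1 =>
    (Nat.ble ((5 * p + 6) / 2) k &&
      Nat.beq (v % 2 ^ ((3 * p + 4) / 2)) (v / 2 ^ (p + 1) % 2 ^ ((3 * p + 4) / 2))) ||
      startsWithPower k v p

/-- Backtracking over binary words of length `k`, written as numbers `v` whose least significant
digit is the last letter, with `S` collecting the length-4 windows met so far. The value `true`
certifies that within `n` further letters every extension of the word contains either a power of
exponent at least `5/2` or more than eight distinct length-4 windows. -/
def deadEnd : ℕ → ℕ → ℕ → List ℕ → Bool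
  | 0, _, _, _ => false
  | n + 1, k, v, S =>
    startsWithPower k v 13 ||
      bif S.any (Nat.beq (v % 16)) then
        deadEnd n (k + 1) (2 * v + 1) S && deadEnd n (k + 1) (2 * v) S
      else
        Nat.ble 8 S.length ||
          (deadEnd n (k + 1) (2 * v + 1) (v % 16 :: S) && deadEnd n (k + 1) (2 * v) (v % 16 :: S))

theorem deadEnd_four_letters : ∀ v : Fin 16, deadEnd 40 4 v [] = true := by
  decide +kernel

/-- The length-`k` prefix of `x` read as a binary numeral. -/
def prefixCode (x : ℕ → Bool) : ℕ → ℕ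
  | 0 => 0
  | k + 1 => 2 * prefixCode x k + (x k).toNat

theorem prefixCode_lt (x : ℕ → Bool) (k : ℕ) : prefixCode x k < 2 ^ k := by
  induction k with
  | zero => simp [prefixCode]
  | succ k ih =>
    have := (x k).toNat_le
    rw [prefixCode, pow_succ]
    omega

theorem testBit_prefixCode (x : ℕ → Bool) {k i : ℕ} (h : i < k) :
    (prefixCode x k).testBit i = x (k - 1 - i) := by
  induction k generalizing i with
  | zero => omega
  | succ k ih =>
    cases i with
    | zero => cases hk : x k <;> simp [prefixCode, Nat.testBit_zero, hk, Nat.add_mod]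
    | succ i =>
      have hdiv : prefixCode x (k + 1) / 2 = prefixCode x k := by
        have := (x k).toNat_le
        rw [prefixCode]
        omega
      rw [Nat.testBit_succ, hdiv, ih (by omega)]
      congr 1
      omega

theorem exists_testBit_eq_of_startsWithPower {k v n : ℕ} (h : startsWithPower k v n = true) :
    ∃ p, 1 ≤ p ∧ p + (3 * p + 1) / 2 ≤ k ∧
      ∀ i, i < (3 * p + 1) / 2 → v.testBit i = v.testBit (i + p) := by
  induction n with
  | zero => simp [startsWithPower] at h
  | succ p ih =>
    simp only [startsWithPower, Bool.or_eq_true, Bool.and_eq_true, Nat.ble_eq, Nat.beq_eq] at h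
    obtain ⟨hk, heq⟩ | h := h
    · refine ⟨p + 1, by omega, by omega, fun i hi => ?_⟩
      have := congrArg (fun c => Nat.testBit c i) heq
      simpa [Nat.testBit_mod_two_pow, Nat.testBit_div_two_pow,
        show i < (3 * p + 4) / 2 by omega] using this
    · exact ih h

/-- `x` contains no factor of period `p` and length `⌈5p/2⌉`. -/
def AvoidsPowers (x : ℕ → Bool) : Prop :=
  ∀ p, 1 ≤ p → ∀ i, ¬ ∀ j, j < (3 * p + 1) / 2 → x (i + j) = x (i + j + p)

/-- The binary digits of `c` spell a length-4 factor of `x`. -/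
def IsWindowCode (x : ℕ → Bool) (c : ℕ) : Prop :=
  c < 2 ^ 4 ∧ ∃ i, ∀ j < 4, c.testBit (3 - j) = x (i + j)

theorem AvoidsPowers.startsWithPower_prefixCode {x : ℕ → Bool} (hx : AvoidsPowers x) (k n : ℕ) :
    startsWithPower k (prefixCode x k) n = false := by
  rw [← Bool.not_eq_true]
  intro h
  obtain ⟨p, hp, hk, hbit⟩ := exists_testBit_eq_of_startsWithPower h
  refine hx p hp (k - p - (3 * p + 1) / 2) fun j hj => ?_
  have h2 := hbit ((3 * p + 1) / 2 - 1 - j) (by omega)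
  rw [testBit_prefixCode x (by omega), testBit_prefixCode x (by omega)] at h2
  convert h2.symm using 2 <;> omega

theorem isWindowCode_prefixCode (x : ℕ → Bool) (k : ℕ) :
    IsWindowCode x (prefixCode x (k + 4) % 16) := by
  refine ⟨Nat.mod_lt _ (by norm_num), k, fun j hj => ?_⟩
  rw [show 16 = 2 ^ 4 by norm_num, Nat.testBit_mod_two_pow, testBit_prefixCode x (by omega),
    decide_eq_true (by omega), Bool.true_and]
  congr 1
  omega

theorem deadEnd_prefixCode {x : ℕ → Bool} (hx : AvoidsPowers x)
    (hC : ∀ S : List ℕ, S.Nodup → (∀ c ∈ S, IsWindowCode x c) → S.length ≤ 8)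
    (n k : ℕ) (S : List ℕ) (hS : S.Nodup) (hw : ∀ c ∈ S, IsWindowCode x c) :
    deadEnd n (k + 4) (prefixCode x (k + 4)) S = false := by
  induction n generalizing k S with
  | zero => rfl
  | succ n ih =>
    have next (T : List ℕ) (hT : T.Nodup) (hw : ∀ c ∈ T, IsWindowCode x c) :
        (deadEnd n (k + 4 + 1) (2 * prefixCode x (k + 4) + 1) T &&
          deadEnd n (k + 4 + 1) (2 * prefixCode x (k + 4)) T) = false := by
      have h := ih (k + 1) T hT hw
      rw [show k + 1 + 4 = k + 4 + 1 by omega, prefixCode] at h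
      cases hk : x (k + 4) <;> rw [hk] at h <;> simp at h <;> simp [h]
    have hany : S.any (Nat.beq (prefixCode x (k + 4) % 16)) = true ↔
        prefixCode x (k + 4) % 16 ∈ S := by
      simp [List.any_eq_true, Nat.beq_eq]
    rw [deadEnd, hx.startsWithPower_prefixCode, Bool.false_or]
    by_cases hmem : prefixCode x (k + 4) % 16 ∈ S
    · rw [hany.2 hmem, cond_true, next S hS hw]
    · have hT : (prefixCode x (k + 4) % 16 :: S).Nodup := List.nodup_cons.2 ⟨hmem, hS⟩
      have hTw : ∀ c ∈ prefixCode x (k + 4) % 16 :: S, IsWindowCode x c :=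
        List.forall_mem_cons.2 ⟨isWindowCode_prefixCode x k, hw⟩
      have hlen := hC _ hT hTw
      rw [List.length_cons] at hlen
      have hble : Nat.ble 8 S.length = false := by
        rw [← Bool.not_eq_true, Nat.ble_eq]
        omega
      rw [Bool.eq_false_iff.2 (mt hany.1 hmem), cond_false, next _ hT hTw, hble, Bool.or_false]

/-- A binary word avoiding powers of exponent at least `5/2` has at least nine factors of
length 4. -/
theorem AvoidsPowers.exists_nine_windows {x : ℕ → Bool} (hx : AvoidsPowers x) :
    ∃ S : List ℕ, S.Nodup ∧ (∀ c ∈ S, IsWindowCode x c) ∧ 9 ≤ S.length := by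
  by_contra! hC
  have h := deadEnd_prefixCode hx (fun S hS hw => Nat.le_of_lt_succ (hC S hS hw)) 40 0 []
    List.nodup_nil (by simp)
  have h' := deadEnd_four_letters ⟨prefixCode x 4, prefixCode_lt x 4⟩
  exact Bool.false_ne_true (h.symm.trans h')

theorem isFactor_map_range (w : InfWord) (i n : ℕ) :
    IsFactor ((List.range n).map fun j => w (i + j)) w :=
  ⟨i, by simp⟩

theorem NoFiveHalves.not_periodic {w : InfWord} (hw : NoFiveHalves w) {p : ℕ} (hp : 1 ≤ p)
    (i : ℕ) : ¬ ∀ j, j < (3 * p + 1) / 2 → w (i + j) = w (i + j + p) := by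
  intro h
  set n := p + (3 * p + 1) / 2 with hn
  set u : Word := (List.range n).map fun j => w (i + j) with hu
  have hul : u.length = n := by simp [hu]
  have hper : HasPeriod u p := by
    refine ⟨hp, fun j hj => ?_⟩
    rw [hul] at hj
    rw [List.getD_eq_getElem _ _ (by omega), List.getD_eq_getElem _ _ (by omega)]
    simpa [hu, add_assoc] using h j (by omega)
  have hmin : HasPeriod u (minPeriod u) :=
    Nat.sInf_mem (s := {q | HasPeriod u q}) ⟨p, hper⟩
  have hle : minPeriod u ≤ p := Nat.sInf_le hper
  have hlt := hw u (by rw [← List.length_pos_iff]; omega) (isFactor_map_range w i n)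
  have hpos : (0 : ℝ) < minPeriod u := by exact_mod_cast hmin.1
  rw [expo, div_lt_iff₀ hpos, hul] at hlt
  have hle' : (minPeriod u : ℝ) ≤ p := by exact_mod_cast hle
  have hge : 5 * (p : ℝ) ≤ 2 * n := by exact_mod_cast (by omega : 5 * p ≤ 2 * n)
  linarith

theorem exists_letter_of_complexity_one {w : InfWord} (h : complexity w 1 = 3) (a : Sigma3) :
    ∃ i, w i = a := by
  by_contra! hne
  have hsub : {u : Word | IsFactor u w ∧ u.length = 1} ⊆
      (((Finset.univ.erase a).image fun b => [b] : Finset Word) : Set Word) := by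
    rintro u ⟨⟨i, hi⟩, hu⟩
    rw [hu] at hi
    simp only [hi]
    simpa using hne i
  have hle := Set.ncard_le_ncard hsub (Finset.finite_toSet _)
  rw [Set.ncard_coe_finset] at hle
  have hcard := hle.trans Finset.card_image_le
  rw [Finset.card_erase_of_mem (Finset.mem_univ a), Finset.card_univ, Fintype.card_fin] at hcard
  rw [complexity] at h
  omega

/-- If the last occurrence of the letter `a` in `w` is at position `m`, the number of
length-`n` factors of `w` exceeds that of its final segment after position `m`. -/
theorem length_lt_complexity {w : InfWord} {a : Sigma3} {m n : ℕ} (ha : w m = a)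
    (hlast : ∀ i, m < i → w i ≠ a) (hn : 1 ≤ n) (hpos : complexity w n ≠ 0) (L : List Word)
    (hL : L.Nodup)
    (hfac : ∀ u ∈ L, ∃ i, u = (List.range n).map fun j => w (m + 1 + i + j)) :
    L.length < complexity w n := by
  set u₀ : Word := (List.range n).map fun j => w (m + j) with hu₀
  have hmem : u₀ ∉ L := by
    intro h
    obtain ⟨i, hi⟩ := hfac _ h
    have h0 : w (m + 0) = w (m + 1 + i + 0) :=
      List.map_inj_left.1 hi 0 (List.mem_range.2 hn)
    exact hlast (m + 1 + i + 0) (by omega) (h0.symm.trans ha)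
  have hsub : ((u₀ :: L).toFinset : Set Word) ⊆ {u : Word | IsFactor u w ∧ u.length = n} := by
    intro u hu
    rw [Finset.mem_coe, List.mem_toFinset, List.mem_cons] at hu
    rcases hu with rfl | hu
    · exact ⟨isFactor_map_range w m n, by simp [hu₀]⟩
    · obtain ⟨i, rfl⟩ := hfac u hu
      exact ⟨isFactor_map_range w (m + 1 + i) n, by simp⟩
  have hle := Set.ncard_le_ncard hsub (Set.finite_of_ncard_ne_zero hpos)
  rw [Set.ncard_coe_finset, List.toFinset_card_of_nodup (List.nodup_cons.2 ⟨hmem, hL⟩),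
    List.length_cons] at hle
  exact hle

/-- If `w` avoids exponents `≥ 5/2` and has factor complexity `2n+1`, then every letter
of Σ₃ occurs infinitely often in `w` (equivalently, every final segment of `w` contains
each of the letters 0, 1, 2). -/
theorem stmt6 (w : InfWord) (hp : NoFiveHalves w)
    (hc : ∀ n : ℕ, complexity w n = 2 * n + 1) :
    ∀ a : Sigma3, ∀ N : ℕ, ∃ i : ℕ, N ≤ i ∧ w i = a := by
  intro a N
  by_contra! hN
  obtain ⟨i₀, hi₀⟩ := exists_letter_of_complexity_one (hc 1) a
  have hbound : ∀ i, w i = a → i ≤ N := fun i hi => by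
    by_contra! h
    exact hN i h.le hi
  set m := Nat.findGreatest (fun i => w i = a) N
  have hwm : w m = a := Nat.findGreatest_spec (P := fun i => w i = a) (hbound i₀ hi₀) hi₀
  have hlast : ∀ i, m < i → w i ≠ a := fun i hi h =>
    Nat.findGreatest_is_greatest hi (hbound i h) h
  set f : Bool → Sigma3 := fun b => bif b then a + 1 else a + 2
  have hfinj : Function.Injective f := by
    have : ∀ a : Sigma3, Function.Injective fun b : Bool => bif b then a + 1 else a + 2 := by
      decide
    exact this a
  have hletter : ∀ a b : Sigma3, b ≠ a →
      (bif decide (b = a + 1) then a + 1 else a + 2) = b := by decide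
  set x : ℕ → Bool := fun i => decide (w (m + 1 + i) = a + 1)
  have hfx : ∀ i, f (x i) = w (m + 1 + i) := fun i =>
    hletter a _ (hlast _ (by omega))
  have hpow : AvoidsPowers x := by
    intro p hp1 i h
    refine hp.not_periodic hp1 (m + 1 + i) fun j hj => ?_
    have := congrArg f (h j hj)
    rw [hfx, hfx] at this
    simpa [add_assoc] using this
  obtain ⟨S, hS, hw, hlen⟩ := hpow.exists_nine_windows
  have hinj : ∀ c ∈ S, ∀ d ∈ S, ((List.range 4).map fun j => f (c.testBit (3 - j))) =
      ((List.range 4).map fun j => f (d.testBit (3 - j))) → c = d := by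
    intro c hc d hd h
    refine Nat.eq_of_testBit_eq fun j => ?_
    rcases Nat.lt_or_ge j 4 with hj | hj
    · have := hfinj (List.map_inj_left.1 h (3 - j) (List.mem_range.2 (by omega)))
      rwa [show 3 - (3 - j) = j by omega] at this
    · have hpow4 : 2 ^ 4 ≤ 2 ^ j := Nat.pow_le_pow_right two_pos hj
      rw [Nat.testBit_lt_two_pow ((hw c hc).1.trans_le hpow4),
        Nat.testBit_lt_two_pow ((hw d hd).1.trans_le hpow4)]
  have hlt := length_lt_complexity (n := 4) hwm hlast (by omega) (by rw [hc]; omega)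
    (S.map fun c => (List.range 4).map fun j => f (c.testBit (3 - j)))
    (hS.map_on hinj) (by
      intro u hu
      obtain ⟨c, hc, rfl⟩ := List.mem_map.1 hu
      obtain ⟨-, i, hi⟩ := hw c hc
      refine ⟨i, List.map_congr_left fun j hj => ?_⟩
      rw [hi j (List.mem_range.1 hj), hfx, add_assoc (m + 1)])
  rw [List.length_map, hc] at hlt
  omega
end
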